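/- arXiv:2301.11700 — 8 statements merged into one kernel-verified Lean document; each statement's English description precedes it below -/
import Mathlib

section
/- Let Ω ⊆ ℂ be a nonempty open, connected and simply connected set, let ρ : Ω → ℂ be holomorphic, let z₀ ∈ Ω and let w₀, w₀′ ∈ ℂ. Then there exists a unique holomorphic function w : Ω → ℂ satisfying Hill's equation w″(z) + (ρ(z)/4)·w(z) = 0 for all z ∈ Ω together with the initial conditions w(z₀) = w₀ and w′(z₀) = w₀′. -/
open Filter Topology

/-- A locally constant cocycle on a simply connected, locally path connected space is trivial:
the local charts `Φ i` of a locally constant sheaf with fibre `F` admit a global section with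
prescribed value at a point. -/
theorem exists_globalSection_of_locallyConstant_cocycle {X F : Type*} [TopologicalSpace X]
    [SimplyConnectedSpace X] [LocallyPathConnectedSpace X] {U : X → Set X}
    (hU : ∀ i, IsOpen (U i)) (hmem : ∀ i, i ∈ U i) {Φ Ψ : X → X → F → F}
    (hΨΦ : ∀ i, ∀ x ∈ U i, ∀ v, Ψ i x (Φ i x v) = v)
    (hΦΨ : ∀ i, ∀ x ∈ U i, ∀ v, Φ i x (Ψ i x v) = v)
    (hloc : ∀ i j v, ∀ x ∈ U i ∩ U j, ∀ᶠ y in 𝓝 x, Ψ j y (Φ i y v) = Ψ j x (Φ i x v))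
    (x₀ : X) (v₀ : F) :
    ∃ s : X → F, s x₀ = v₀ ∧ ∀ x, ∃ u, ∀ᶠ y in 𝓝 x, s y = Φ x y u := by
  let _ : TopologicalSpace F := ⊥
  have : DiscreteTopology F := ⟨rfl⟩
  let Z : FiberBundleCore X X F :=
    { baseSet := U
      isOpen_baseSet := hU
      indexAt := id
      mem_baseSet_at := hmem
      coordChange := fun i j x v ↦ Ψ j x (Φ i x v)
      coordChange_self := hΨΦ
      continuousOn_coordChange := by
        rintro i j ⟨x, v⟩ ⟨hx, -⟩
        refine ContinuousAt.continuousWithinAt ?_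
        rw [ContinuousAt, nhds_discrete F, tendsto_pure, nhds_prod_eq, nhds_discrete F,
          prod_pure, eventually_map]
        exact hloc i j v x hx
      coordChange_comp := by
        rintro i j k x ⟨⟨-, hj⟩, -⟩ v
        simp only [hΦΨ j x hj] }
  have hcov : IsCoveringMap Z.proj :=
    IsFiberBundle.isCoveringMap (F := F) fun x ↦ ⟨Z.localTriv x, hmem x⟩
  obtain ⟨f, ⟨hf₀, hf⟩, -⟩ := hcov.existsUnique_continuousMap_lifts (ContinuousMap.id X) x₀
    (⟨x₀, Ψ x₀ x₀ v₀⟩ : Z.TotalSpace) rfl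
  have hproj : ∀ x, (f x).1 = x := fun x ↦ congrFun hf x
  have htriv : ∀ i x, (Z.localTriv i (f x)).2 = Ψ i x (Φ x x (f x).2) := fun i x ↦ by
    rw [Z.localTriv_apply]
    change Ψ i (f x).1 (Φ (f x).1 (f x).1 (f x).2) = _
    rw [hproj]
  refine ⟨fun x ↦ Φ x x (f x).2, ?_, fun x ↦ ⟨(f x).2, ?_⟩⟩
  · change Φ x₀ x₀ (f x₀).2 = v₀
    rw [hf₀]
    exact hΦΨ _ _ (hmem _) _
  · have hcont : ContinuousAt (fun y ↦ (Z.localTriv x (f y)).2) x := by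
      have hsrc : f x ∈ (Z.localTriv x).source := by
        rw [(Z.localTriv x).mem_source]
        change (f x).1 ∈ U x
        rw [hproj]
        exact hmem x
      exact continuous_snd.continuousAt.comp
        (ContinuousAt.comp (f := f) ((Z.localTriv x).continuousAt hsrc) f.continuous.continuousAt)
    rw [ContinuousAt, nhds_discrete F, tendsto_pure] at hcont
    filter_upwards [hcont, (hU x).mem_nhds (hmem x)] with y hy hyU
    rw [htriv, htriv] at hy
    exact (hΦΨ x y hyU _).symm.trans (congrArg (Φ x y) (hy.trans (hΨΦ x x (hmem x) _)))

/-- `w` is a holomorphic solution of `w'' + q w = 0` on `U`. -/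
structure IsHillSolution (q : ℂ → ℂ) (U : Set ℂ) (w : ℂ → ℂ) : Prop where
  differentiableOn : DifferentiableOn ℂ w U
  equation : ∀ z ∈ U, deriv (deriv w) z + q z * w z = 0

namespace IsHillSolution

variable {q f g φ ψ : ℂ → ℂ} {U V : Set ℂ} {c z : ℂ}

theorem mono (hf : IsHillSolution q V f) (h : U ⊆ V) : IsHillSolution q U f :=
  ⟨hf.differentiableOn.mono h, fun z hz ↦ hf.equation z (h hz)⟩

theorem hasDerivAt (hf : IsHillSolution q U f) (hU : IsOpen U) (hz : z ∈ U) :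
    HasDerivAt f (deriv f z) z :=
  (hf.differentiableOn.differentiableAt (hU.mem_nhds hz)).hasDerivAt

theorem hasDerivAt_deriv (hf : IsHillSolution q U f) (hU : IsOpen U) (hz : z ∈ U) :
    HasDerivAt (deriv f) (-(q z * f z)) z := by
  have h := ((hf.differentiableOn.deriv hU).differentiableAt (hU.mem_nhds hz)).hasDerivAt
  rwa [eq_neg_of_add_eq_zero_left (hf.equation z hz)] at h

theorem const_mul (hf : IsHillSolution q U f) (a : ℂ) :
    IsHillSolution q U (fun z ↦ a * f z) := by
  refine ⟨hf.differentiableOn.const_mul a, fun z hz ↦ ?_⟩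
  have h : deriv (fun z ↦ a * f z) = fun z ↦ a * deriv f z := funext fun z ↦
    deriv_const_mul_field a
  rw [h, deriv_const_mul_field]
  linear_combination a * hf.equation z hz

theorem add (hf : IsHillSolution q U f) (hg : IsHillSolution q U g) (hU : IsOpen U) :
    IsHillSolution q U (fun z ↦ f z + g z) := by
  refine ⟨hf.differentiableOn.add hg.differentiableOn, fun z hz ↦ ?_⟩
  have h : deriv (fun z ↦ f z + g z) =ᶠ[𝓝 z] fun z ↦ deriv f z + deriv g z := by
    filter_upwards [hU.mem_nhds hz] with x hx
    exact ((hf.hasDerivAt hU hx).add (hg.hasDerivAt hU hx)).deriv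
  rw [h.deriv_eq, ((hf.hasDerivAt_deriv hU hz).fun_add (hg.hasDerivAt_deriv hU hz)).deriv]
  ring

/-- The Wronskian of two solutions is constant. -/
theorem wronskian_eq (hf : IsHillSolution q U f) (hg : IsHillSolution q U g) (hU : IsOpen U)
    (hU' : IsPreconnected U) (hc : c ∈ U) (hz : z ∈ U) :
    f z * deriv g z - deriv f z * g z = f c * deriv g c - deriv f c * g c := by
  have h : ∀ x ∈ U, HasDerivAt (fun x ↦ f x * deriv g x - deriv f x * g x) 0 x := fun x hx ↦
    (((hf.hasDerivAt hU hx).mul (hg.hasDerivAt_deriv hU hx)).sub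
      ((hf.hasDerivAt_deriv hU hx).mul (hg.hasDerivAt hU hx))).congr_deriv (by ring)
  exact hU.is_const_of_deriv_eq_zero hU'
    (fun x hx ↦ (h x hx).differentiableAt.differentiableWithinAt) (fun x hx ↦ (h x hx).deriv) hz hc

/-- Two solutions with the same initial data agree, provided a fundamental system exists. -/
theorem eqOn_of_wronskian_eq_one (hφ : IsHillSolution q U φ) (hψ : IsHillSolution q U ψ)
    (hW : ∀ x ∈ U, φ x * deriv ψ x - deriv φ x * ψ x = 1) (hf : IsHillSolution q U f)
    (hg : IsHillSolution q U g) (hU : IsOpen U) (hU' : IsPreconnected U) (hc : c ∈ U)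
    (h₀ : f c = g c) (h₁ : deriv f c = deriv g c) : Set.EqOn f g U := by
  intro z hz
  have e₁ := hf.wronskian_eq hφ hU hU' hc hz
  have e₂ := hg.wronskian_eq hφ hU hU' hc hz
  have e₃ := hf.wronskian_eq hψ hU hU' hc hz
  have e₄ := hg.wronskian_eq hψ hU hU' hc hz
  rw [h₀, h₁] at e₁ e₃
  linear_combination φ z * (e₃ - e₄) - ψ z * (e₁ - e₂) - (f z - g z) * hW z hz

end IsHillSolution

open Metric in
/-- A holomorphic function on a disc has a second antiderivative vanishing to second order
at the centre, with the obvious bounds. -/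
theorem exists_second_antideriv_ball {f : ℂ → ℂ} {c : ℂ} {r : ℝ} (hr : 0 < r)
    (hf : DifferentiableOn ℂ f (ball c r)) :
    ∃ h : ℂ → ℂ, DifferentiableOn ℂ h (ball c r) ∧ h c = 0 ∧ deriv h c = 0 ∧
      (∀ z ∈ ball c r, deriv (deriv h) z = f z) ∧
      ∀ M : ℝ, (∀ z ∈ ball c r, ‖f z‖ ≤ M) →
        (∀ z ∈ ball c r, ‖deriv h z‖ ≤ M * r) ∧ ∀ z ∈ ball c r, ‖h z‖ ≤ M * r * r := by
  have hc : c ∈ ball c r := mem_ball_self hr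
  have key : ∀ {f : ℂ → ℂ}, DifferentiableOn ℂ f (ball c r) → ∃ g : ℂ → ℂ, g c = 0 ∧
      (∀ z ∈ ball c r, HasDerivAt g (f z) z) ∧
      ∀ M : ℝ, (∀ z ∈ ball c r, ‖f z‖ ≤ M) → ∀ z ∈ ball c r, ‖g z‖ ≤ M * r := by
    intro f hf
    obtain ⟨g, hg₀, hg⟩ := hf.isExactOn_ball.with_val_at c 0
    refine ⟨g, hg₀, hg, fun M hM z hz ↦ ?_⟩
    have h := (convex_ball c r).norm_image_sub_le_of_norm_deriv_le
      (fun x hx ↦ (hg x hx).differentiableAt) (fun x hx ↦ (hg x hx).deriv.symm ▸ hM x hx) hc hz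
    rw [hg₀, sub_zero] at h
    exact h.trans (mul_le_mul_of_nonneg_left (mem_ball_iff_norm.1 hz).le
      ((norm_nonneg _).trans (hM c hc)))
  obtain ⟨g, hg₀, hg, hgM⟩ := key hf
  obtain ⟨h, hh₀, hh, hhM⟩ :=
    key (fun z hz ↦ (hg z hz).differentiableAt.differentiableWithinAt)
  refine ⟨h, fun z hz ↦ (hh z hz).differentiableAt.differentiableWithinAt, hh₀,
    (hh c hc).deriv.trans hg₀, fun z hz ↦ ?_, fun M hM ↦
      ⟨fun z hz ↦ (hh z hz).deriv.symm ▸ hgM M hM z hz, hhM _ (hgM M hM)⟩⟩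
  have hev : deriv h =ᶠ[𝓝 z] g := by
    filter_upwards [isOpen_ball.mem_nhds hz] with x hx using (hh x hx).deriv
  exact hev.deriv_eq.trans (hg z hz).deriv

open Metric in
/-- Picard iteration: on a sufficiently small disc the initial value problem for `w'' + q w = 0`
with data at the centre is solvable. -/
theorem exists_isHillSolution_ball {q : ℂ → ℂ} {c : ℂ} {r C : ℝ} (hr : 0 < r)
    (hq : DifferentiableOn ℂ q (ball c r)) (hC : ∀ z ∈ ball c r, ‖q z‖ ≤ C)
    (hCr : C * r * r ≤ 1 / 2) (a b : ℂ) :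
    ∃ w : ℂ → ℂ, IsHillSolution q (ball c r) w ∧ w c = a ∧ deriv w c = b := by
  have hc : c ∈ ball c r := mem_ball_self hr
  have hC₀ : 0 ≤ C := (norm_nonneg _).trans (hC c hc)
  have step : ∀ f : ℂ → ℂ, ∃ h : ℂ → ℂ, DifferentiableOn ℂ f (ball c r) →
      DifferentiableOn ℂ h (ball c r) ∧ h c = 0 ∧ deriv h c = 0 ∧
      (∀ z ∈ ball c r, deriv (deriv h) z = -(q z * f z)) ∧
      ∀ M : ℝ, (∀ z ∈ ball c r, ‖-(q z * f z)‖ ≤ M) →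
        (∀ z ∈ ball c r, ‖deriv h z‖ ≤ M * r) ∧ ∀ z ∈ ball c r, ‖h z‖ ≤ M * r * r := by
    intro f
    by_cases hf : DifferentiableOn ℂ f (ball c r)
    · obtain ⟨h, hh⟩ := exists_second_antideriv_ball hr (hq.mul hf).neg
      exact ⟨h, fun _ ↦ hh⟩
    · exact ⟨0, fun h ↦ absurd h hf⟩
  choose T hT using step
  let F : ℕ → ℂ → ℂ := fun n ↦ T^[n] (fun z ↦ a + b * (z - c))
  have hF_succ : ∀ n, F (n + 1) = T (F n) := fun n ↦ Function.iterate_succ_apply' _ _ _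
  have hF₀' : deriv (F 0) = fun _ ↦ b := by
    funext z
    exact ((((hasDerivAt_id z).sub_const c).const_mul b).const_add a).deriv.trans (mul_one b)
  have hFd : ∀ n, DifferentiableOn ℂ (F n) (ball c r) := by
    intro n
    induction n with
    | zero =>
      change DifferentiableOn ℂ (fun z ↦ a + b * (z - c)) (ball c r)
      fun_prop
    | succ n ih => rw [hF_succ]; exact (hT _ ih).1
  set M : ℝ := ‖a‖ + ‖b‖ * r
  have hM : 0 ≤ M := by positivity
  have hqF : ∀ {f : ℂ → ℂ} {K : ℝ}, (∀ z ∈ ball c r, ‖f z‖ ≤ K) →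
      ∀ z ∈ ball c r, ‖-(q z * f z)‖ ≤ C * K := fun h z hz ↦ by
    rw [norm_neg, norm_mul]
    exact mul_le_mul (hC z hz) (h z hz) (norm_nonneg _) hC₀
  have hFb : ∀ n, ∀ z ∈ ball c r, ‖F n z‖ ≤ M * (1 / 2) ^ n := by
    intro n
    induction n with
    | zero =>
      intro z hz
      rw [pow_zero, mul_one]
      refine (norm_add_le _ _).trans (add_le_add le_rfl ?_)
      rw [norm_mul]
      exact mul_le_mul_of_nonneg_left (mem_ball_iff_norm.1 hz).le (norm_nonneg _)
    | succ n ih =>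
      intro z hz
      rw [hF_succ]
      refine (((hT _ (hFd n)).2.2.2.2 _ (hqF ih)).2 z hz).trans ?_
      calc C * (M * (1 / 2) ^ n) * r * r = (C * r * r) * (M * (1 / 2) ^ n) := by ring
        _ ≤ (1 / 2) * (M * (1 / 2) ^ n) := mul_le_mul_of_nonneg_right hCr (by positivity)
        _ = M * (1 / 2) ^ (n + 1) := by ring
  have hFb' : ∀ n, ∀ z ∈ ball c r, ‖deriv (F n) z‖ ≤ (‖b‖ + 2 * C * M * r) * (1 / 2) ^ n := by
    rintro (_ | n) z hz
    · rw [hF₀', pow_zero, mul_one]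
      exact le_add_of_nonneg_right (by positivity)
    · rw [hF_succ]
      refine (((hT _ (hFd n)).2.2.2.2 _ (hqF (hFb n))).1 z hz).trans ?_
      calc C * (M * (1 / 2) ^ n) * r = (2 * C * M * r) * (1 / 2) ^ (n + 1) := by ring
        _ ≤ _ := mul_le_mul_of_nonneg_right (le_add_of_nonneg_left (norm_nonneg _)) (by positivity)
  have hsum : ∀ K : ℝ, Summable fun n : ℕ ↦ K * (1 / 2 : ℝ) ^ n := fun K ↦
    summable_geometric_two.mul_left K
  let w : ℂ → ℂ := fun z ↦ ∑' n, F n z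
  have hw' : ∀ z ∈ ball c r, deriv w z = ∑' n, deriv (F n) z := fun z hz ↦
    (Complex.hasSum_deriv_of_summable_norm (hsum _) hFd isOpen_ball hFb hz).tsum_eq.symm
  refine ⟨w, ⟨Complex.differentiableOn_tsum_of_summable_norm (hsum _) hFd isOpen_ball hFb,
    fun z hz ↦ ?_⟩, ?_, ?_⟩
  · have hev : deriv w =ᶠ[𝓝 z] fun x ↦ ∑' n, deriv (F n) x := by
      filter_upwards [isOpen_ball.mem_nhds hz] with x hx using hw' x hx
    have hs := Complex.hasSum_deriv_of_summable_norm (hsum _)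
      (fun n ↦ (hFd n).deriv isOpen_ball) isOpen_ball hFb' hz
    have hsucc : ∀ n, deriv (deriv (F (n + 1))) z = -q z * F n z := fun n ↦ by
      rw [hF_succ, (hT _ (hFd n)).2.2.2.1 z hz, neg_mul]
    rw [hev.deriv_eq, ← hs.tsum_eq, hs.summable.tsum_eq_zero_add, hF₀', deriv_const,
      tsum_congr hsucc, tsum_mul_left]
    ring
  · change ∑' n, F n c = a
    rw [tsum_eq_single 0]
    · change a + b * (c - c) = a
      ring
    · rintro (_ | n) hn
      · exact absurd rfl hn
      · rw [hF_succ]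
        exact (hT _ (hFd n)).2.1
  · rw [hw' c hc, tsum_eq_single 0, hF₀']
    rintro (_ | n) hn
    · exact absurd rfl hn
    · rw [hF_succ]
      exact (hT _ (hFd n)).2.2.1

open Metric in
/-- Around each point of an open set there is a disc carrying a normalized fundamental system. -/
theorem exists_fundamentalSystem {q : ℂ → ℂ} {U : Set ℂ} {c : ℂ} (hU : IsOpen U)
    (hq : DifferentiableOn ℂ q U) (hc : c ∈ U) :
    ∃ r > 0, ball c r ⊆ U ∧ ∃ φ ψ : ℂ → ℂ,
      IsHillSolution q (ball c r) φ ∧ IsHillSolution q (ball c r) ψ ∧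
      ∀ z ∈ ball c r, φ z * deriv ψ z - deriv φ z * ψ z = 1 := by
  set C : ℝ := ‖q c‖ + 1
  have hC₀ : 0 < C := by positivity
  have hqc : ∀ᶠ z in 𝓝 c, ‖q z‖ < C :=
    (hq.differentiableAt (hU.mem_nhds hc)).continuousAt.norm.eventually_lt_const (lt_add_one _)
  obtain ⟨ε, hε, hball⟩ := Metric.eventually_nhds_iff_ball.1 (hqc.and (hU.mem_nhds hc))
  have hr : 0 < min ε (min 1 (1 / (2 * C))) := by positivity
  set r := min ε (min 1 (1 / (2 * C)))
  have hsub : ball c r ⊆ ball c ε := ball_subset_ball (min_le_left _ _)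
  have hrU : ball c r ⊆ U := fun z hz ↦ (hball z (hsub hz)).2
  have hr₁ : r ≤ 1 := (min_le_right _ _).trans (min_le_left _ _)
  have hr₂ : C * r ≤ 1 / 2 := by
    have h : r ≤ 1 / (2 * C) := (min_le_right _ _).trans (min_le_right _ _)
    calc C * r ≤ C * (1 / (2 * C)) := mul_le_mul_of_nonneg_left h hC₀.le
      _ = 1 / 2 := by field_simp
  have hCr : C * r * r ≤ 1 / 2 := (mul_le_of_le_one_right (by positivity) hr₁).trans hr₂
  have hsol := exists_isHillSolution_ball hr (hq.mono hrU)
    (fun z hz ↦ (hball z (hsub hz)).1.le) hCr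
  obtain ⟨φ, hφ, hφ₀, hφ₁⟩ := hsol 1 0
  obtain ⟨ψ, hψ, hψ₀, hψ₁⟩ := hsol 0 1
  refine ⟨r, hr, hrU, φ, ψ, hφ, hψ, fun z hz ↦ ?_⟩
  rw [hφ.wronskian_eq hψ isOpen_ball (convex_ball c r).isPreconnected (mem_ball_self hr) hz,
    hφ₀, hφ₁, hψ₀, hψ₁]
  ring


/-- **Existence and uniqueness for Hill's equation.**
Let `Ω ⊆ ℂ` be a nonempty open, connected and simply connected set, let `ρ` be
holomorphic on `Ω`, let `z₀ ∈ Ω` and `w₀, w₀' ∈ ℂ`.  Then there is a holomorphic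
function `w` on `Ω` with `w'' + (ρ/4)·w = 0` on `Ω`, `w z₀ = w₀`, `w' z₀ = w₀'`,
and any other holomorphic solution with the same initial data agrees with `w` on `Ω`. -/
theorem hill_exists_unique (Ω : Set ℂ) (hΩo : IsOpen Ω) (hΩc : IsConnected Ω)
    (hΩs : SimplyConnectedSpace Ω) (ρ : ℂ → ℂ) (hρ : DifferentiableOn ℂ ρ Ω)
    (z₀ : ℂ) (hz₀ : z₀ ∈ Ω) (w₀ w₀' : ℂ) :
    ∃ w : ℂ → ℂ,
      (DifferentiableOn ℂ w Ω ∧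
        (∀ z ∈ Ω, deriv (deriv w) z + ρ z / 4 * w z = 0) ∧
        w z₀ = w₀ ∧ deriv w z₀ = w₀') ∧
      ∀ v : ℂ → ℂ, DifferentiableOn ℂ v Ω →
        (∀ z ∈ Ω, deriv (deriv v) z + ρ z / 4 * v z = 0) →
        v z₀ = w₀ → deriv v z₀ = w₀' → Set.EqOn v w Ω := by
  set q : ℂ → ℂ := fun z ↦ ρ z / 4
  have hq : DifferentiableOn ℂ q Ω := hρ.div_const 4
  have : LocallyPathConnectedSpace Ω := hΩo.locallyPathConnectedSpace
  have hsys := fun c : Ω ↦ exists_fundamentalSystem hΩo hq c.2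
  choose r hr hrΩ φ ψ hφ hψ hW using hsys
  have hmem : ∀ c : Ω, (c : ℂ) ∈ Metric.ball (c : ℂ) (r c) := fun c ↦ Metric.mem_ball_self (hr c)
  obtain ⟨s, hs₀, hs⟩ := exists_globalSection_of_locallyConstant_cocycle
    (U := fun c : Ω ↦ {x : Ω | (x : ℂ) ∈ Metric.ball (c : ℂ) (r c)})
    (Φ := fun c x (v : ℂ × ℂ) ↦ (v.1 * φ c x + v.2 * ψ c x,
      v.1 * deriv (φ c) x + v.2 * deriv (ψ c) x))
    (Ψ := fun c x (v : ℂ × ℂ) ↦ (v.1 * deriv (ψ c) x - v.2 * ψ c x,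
      v.2 * φ c x - v.1 * deriv (φ c) x))
    (fun c ↦ Metric.isOpen_ball.preimage continuous_subtype_val) hmem
    (fun c x hx v ↦ Prod.ext (by linear_combination v.1 * hW c x hx)
      (by linear_combination v.2 * hW c x hx))
    (fun c x hx v ↦ Prod.ext (by linear_combination v.1 * hW c x hx)
      (by linear_combination v.2 * hW c x hx))
    (fun i j v x hx ↦ by
      have hB : IsOpen (Metric.ball (i : ℂ) (r i) ∩ Metric.ball (j : ℂ) (r j)) :=
        Metric.isOpen_ball.inter Metric.isOpen_ball
      have hB' : IsPreconnected (Metric.ball (i : ℂ) (r i) ∩ Metric.ball (j : ℂ) (r j)) :=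
        ((convex_ball _ _).inter (convex_ball _ _)).isPreconnected
      have hφi := (hφ i).mono (Set.inter_subset_left (t := Metric.ball (j : ℂ) (r j)))
      have hψi := (hψ i).mono (Set.inter_subset_left (t := Metric.ball (j : ℂ) (r j)))
      have hφj := (hφ j).mono (Set.inter_subset_right (s := Metric.ball (i : ℂ) (r i)))
      have hψj := (hψ j).mono (Set.inter_subset_right (s := Metric.ball (i : ℂ) (r i)))
      filter_upwards [(hB.preimage continuous_subtype_val).mem_nhds hx] with y hy
      have e₁ := hφi.wronskian_eq hφj hB hB' hx hy
      have e₂ := hφi.wronskian_eq hψj hB hB' hx hy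
      have e₃ := hψi.wronskian_eq hφj hB hB' hx hy
      have e₄ := hψi.wronskian_eq hψj hB hB' hx hy
      exact Prod.ext (by linear_combination v.1 * e₂ + v.2 * e₄)
        (by linear_combination -v.1 * e₁ - v.2 * e₃))
    ⟨z₀, hz₀⟩ (w₀, w₀')
  classical
  let w : ℂ → ℂ := fun z ↦ if hz : z ∈ Ω then (s ⟨z, hz⟩).1 else 0
  have hloc : ∀ z (hz : z ∈ Ω), ∃ W : ℂ → ℂ, ∃ B, IsOpen B ∧ z ∈ B ∧ IsHillSolution q B W ∧
      w =ᶠ[𝓝 z] W ∧ deriv W z = (s ⟨z, hz⟩).2 := by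
    intro z hz
    obtain ⟨u, hu⟩ := hs ⟨z, hz⟩
    have hB := Metric.isOpen_ball (x := z) (ε := r ⟨z, hz⟩)
    have h₁ := hφ ⟨z, hz⟩
    have h₂ := hψ ⟨z, hz⟩
    have hsol := (h₁.const_mul u.1).add (h₂.const_mul u.2) hB
    refine ⟨_, _, hB, hmem ⟨z, hz⟩, hsol, ?_, ?_⟩
    · rw [nhds_subtype_eq_comap, eventually_comap] at hu
      filter_upwards [hu, hΩo.mem_nhds hz] with x hx hxΩ
      simp only [w, dif_pos hxΩ]
      rw [hx ⟨x, hxΩ⟩ rfl]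
    · rw [hu.self_of_nhds]
      exact (((h₁.hasDerivAt hB (hmem ⟨z, hz⟩)).const_mul u.1).add
        ((h₂.hasDerivAt hB (hmem ⟨z, hz⟩)).const_mul u.2)).deriv
  have hw : IsHillSolution q Ω w := by
    refine ⟨fun z hz ↦ ?_, fun z hz ↦ ?_⟩ <;>
      obtain ⟨W, B, hB, hzB, hW, hwW, -⟩ := hloc z hz
    · exact (hwW.differentiableAt_iff.2
        (hW.hasDerivAt hB hzB).differentiableAt).differentiableWithinAt
    · rw [hwW.deriv.deriv_eq, hwW.eq_of_nhds]
      exact hW.equation z hzB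
  have hw₀ : w z₀ = w₀ := by simp only [w, dif_pos hz₀, hs₀]
  have hw₁ : deriv w z₀ = w₀' := by
    obtain ⟨W, -, -, -, -, hwW, hW₁⟩ := hloc z₀ hz₀
    rw [hwW.deriv_eq, hW₁, hs₀]
  refine ⟨w, ⟨hw.differentiableOn, hw.equation, hw₀, hw₁⟩, fun v hv hv' hv₀ hv₁ ↦ ?_⟩
  refine (hv.analyticOnNhd hΩo).eqOn_of_preconnected_of_eventuallyEq
    (hw.differentiableOn.analyticOnNhd hΩo) hΩc.isPreconnected hz₀ ?_
  filter_upwards [Metric.ball_mem_nhds z₀ (hr ⟨z₀, hz₀⟩)]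
  exact (hφ ⟨z₀, hz₀⟩).eqOn_of_wronskian_eq_one (hψ _) (hW _)
    ((IsHillSolution.mk hv hv').mono (hrΩ _)) (hw.mono (hrΩ _)) Metric.isOpen_ball
    (convex_ball _ _).isPreconnected (hmem ⟨z₀, hz₀⟩) (hv₀.trans hw₀.symm) (hv₁.trans hw₁.symm)
end

section
/- Let D ⊂ ℂ be the open unit disk, let ρ : D → ℂ be holomorphic and let w₀, w₀′ ∈ ℂ. For each n, let ρₙ denote the Taylor polynomial of ρ at 0 of order n, and let wₙ : D → ℂ be the unique holomorphic solution of wₙ″ + (ρₙ/4)wₙ = 0 with wₙ(0) = w₀ and wₙ′(0) = w₀′. Then the sequence (wₙ) converges locally uniformly on D to the unique holomorphic solution w of w″ + (ρ/4)w = 0 with w(0) = w₀ and w′(0) = w₀′. -/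
open Filter Metric Topology

/-- The Taylor polynomials at the center of a disk of a function holomorphic on that disk
converge to it locally uniformly on the disk. -/
theorem DifferentiableOn.tendstoLocallyUniformlyOn_taylor {f : ℂ → ℂ} {c : ℂ} {R : ℝ}
    (hf : DifferentiableOn ℂ f (ball c R)) :
    TendstoLocallyUniformlyOn
      (fun (n : ℕ) z => ∑ k ∈ Finset.range (n + 1),
        iteratedDeriv k f c / (Nat.factorial k) * (z - c) ^ k) f atTop (ball c R) := by
  rw [tendstoLocallyUniformlyOn_iff_forall_isCompact isOpen_ball]
  intro K hKR hK
  rcases le_or_gt R 0 with hR | hR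
  · rw [ball_eq_empty.2 hR, Set.subset_empty_iff] at hKR
    exact hKR ▸ tendstoUniformlyOn_empty
  obtain ⟨r, ⟨hr0, hrR⟩, hKr⟩ := exists_pos_lt_subset_ball hR hK.isClosed hKR
  obtain ⟨s, hrs, hsR⟩ := exists_between hrR
  lift r to NNReal using hr0.le
  lift s to NNReal using (hr0.trans hrs).le
  have hp := (hf.mono (closedBall_subset_ball hsR)).hasFPowerSeriesOnBall
    (NNReal.coe_pos.1 (hr0.trans hrs))
  have hu := (hp.tendstoUniformlyOn' (ENNReal.coe_lt_coe.2 (NNReal.coe_lt_coe.1 hrs))).mono hKr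
  have hterm (k : ℕ) (y : ℂ) :
      cauchyPowerSeries f c s k (fun _ => y) = iteratedDeriv k f c / (Nat.factorial k) * y ^ k := by
    have h := hp.factorial_smul y k
    rw [iteratedFDeriv_apply_eq_iteratedDeriv_mul_prod] at h
    have hk : (Nat.factorial k : ℂ) ≠ 0 := Nat.cast_ne_zero.2 (Nat.factorial_ne_zero k)
    simp only [nsmul_eq_mul, Finset.prod_const, Finset.card_univ, Fintype.card_fin,
      smul_eq_mul] at h
    field_simp
    linear_combination h
  rw [Metric.tendstoUniformlyOn_iff] at hu ⊢
  intro ε hε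
  filter_upwards [(tendsto_add_atTop_nat 1).eventually (hu ε hε)] with n hn z hz
  simpa only [FormalMultilinearSeries.partialSum, hterm] using hn z hz

/-- Grönwall estimate along rays for approximate solutions of `d'' + q d = 0` on a disk of
radius at most one. -/
theorem norm_le_gronwallBound_of_norm_deriv_deriv_add_mul_le {d q : ℂ → ℂ} {R K ε : ℝ}
    (hR : R ≤ 1) (hK : 1 ≤ K) (hd : DifferentiableOn ℂ d (ball 0 R))
    (hq : ∀ z ∈ ball (0 : ℂ) R, ‖q z‖ ≤ K)
    (hε : ∀ z ∈ ball (0 : ℂ) R, ‖deriv (deriv d) z + q z * d z‖ ≤ ε)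
    {z : ℂ} (hz : z ∈ ball 0 R) :
    ‖d z‖ ≤ gronwallBound ‖(d 0, deriv d 0)‖ K ε 1 := by
  have hz1 : ‖z‖ ≤ 1 := (mem_ball_zero_iff.1 hz).le.trans hR
  have hmem {t : ℝ} (ht : t ∈ Set.Icc (0 : ℝ) 1) : (t : ℂ) * z ∈ ball (0 : ℂ) R := by
    rw [mem_ball_zero_iff] at hz ⊢
    rw [norm_mul, Complex.norm_real, Real.norm_of_nonneg ht.1]
    exact (mul_le_of_le_one_left (norm_nonneg z) ht.2).trans_lt hz
  have hray {g : ℂ → ℂ} (hg : DifferentiableOn ℂ g (ball 0 R)) {t : ℝ}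
      (ht : t ∈ Set.Icc (0 : ℝ) 1) :
      HasDerivAt (fun s : ℝ => g (s * z)) (deriv g (t * z) * z) t := by
    have h1 := (hg.differentiableAt (isOpen_ball.mem_nhds (hmem ht))).hasDerivAt
    have h2 : HasDerivAt (fun s : ℝ => (s : ℂ) * z) z t := by
      simpa using (Complex.ofRealCLM.hasDerivAt (x := t)).mul_const z
    exact h1.comp t h2
  have hF {t : ℝ} (ht : t ∈ Set.Icc (0 : ℝ) 1) :=
    (hray hd ht).prodMk (hray (hd.deriv isOpen_ball) ht)
  have hbound : ∀ t ∈ Set.Ico (0 : ℝ) 1,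
      ‖(deriv d (t * z) * z, deriv (deriv d) (t * z) * z)‖
        ≤ K * ‖(d (t * z), deriv d (t * z))‖ + ε := by
    intro t ht
    have hm := hmem (Set.Ico_subset_Icc_self ht)
    have he := hε _ hm
    have hε0 : 0 ≤ ε := (norm_nonneg _).trans he
    have hle {a : ℂ} : ‖a * z‖ ≤ ‖a‖ := by
      rw [norm_mul]
      exact mul_le_of_le_one_right (norm_nonneg a) hz1
    refine max_le ?_ ?_
    · calc ‖deriv d (t * z) * z‖ ≤ ‖deriv d (t * z)‖ := hle
        _ ≤ ‖(d (t * z), deriv d (t * z))‖ := norm_snd_le (d (t * z), deriv d (t * z))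
        _ ≤ K * ‖(d (t * z), deriv d (t * z))‖ := le_mul_of_one_le_left (norm_nonneg _) hK
        _ ≤ _ := le_add_of_nonneg_right hε0
    · calc ‖deriv (deriv d) (t * z) * z‖ ≤ ‖deriv (deriv d) (t * z)‖ := hle
        _ = ‖(deriv (deriv d) (t * z) + q (t * z) * d (t * z)) - q (t * z) * d (t * z)‖ := by
            rw [add_sub_cancel_right]
        _ ≤ ε + ‖q (t * z)‖ * ‖d (t * z)‖ :=
            (norm_sub_le _ _).trans (by rw [norm_mul]; gcongr)
        _ ≤ ε + K * ‖(d (t * z), deriv d (t * z))‖ := by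
            gcongr
            · exact hq _ hm
            · exact norm_fst_le (d (t * z), deriv d (t * z))
        _ = _ := add_comm _ _
  have key := norm_le_gronwallBound_of_norm_deriv_right_le
    (fun t ht => (hF ht).continuousAt.continuousWithinAt)
    (fun t ht => (hF (Set.Ico_subset_Icc_self ht)).hasDerivWithinAt)
    (δ := ‖(d 0, deriv d 0)‖) (by simp only [Complex.ofReal_zero, zero_mul, le_refl]) hbound 1
    (Set.right_mem_Icc.2 zero_le_one)
  simp only [Complex.ofReal_one, one_mul, sub_zero] at key
  exact (norm_fst_le (d z, deriv d z)).trans key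

/-- Solutions of `u'' + q u = 0` on a disk of radius at most one with fixed initial data depend
continuously on the potential `q`, for locally uniform convergence. -/
theorem tendstoLocallyUniformlyOn_of_deriv_deriv_add_mul_eq_zero {ι : Type*} {l : Filter ι}
    {q u : ℂ → ℂ} {qs us : ι → ℂ → ℂ} {R : ℝ} (hR : R ≤ 1)
    (hq : ContinuousOn q (ball 0 R)) (hqs : TendstoLocallyUniformlyOn qs q l (ball 0 R))
    (hu : DifferentiableOn ℂ u (ball 0 R))
    (hode : ∀ z ∈ ball (0 : ℂ) R, deriv (deriv u) z + q z * u z = 0)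
    (hus : ∀ i, DifferentiableOn ℂ (us i) (ball 0 R))
    (hodes : ∀ i, ∀ z ∈ ball (0 : ℂ) R, deriv (deriv (us i)) z + qs i z * us i z = 0)
    (h0 : ∀ i, us i 0 = u 0) (h0' : ∀ i, deriv (us i) 0 = deriv u 0) :
    TendstoLocallyUniformlyOn us u l (ball 0 R) := by
  rw [tendstoLocallyUniformlyOn_iff_forall_isCompact isOpen_ball] at hqs ⊢
  intro C hCR hC
  obtain ⟨r, hrR, hCr⟩ := exists_lt_subset_ball hC.isClosed hCR
  have hsub : closedBall (0 : ℂ) r ⊆ ball 0 R := closedBall_subset_ball hrR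
  have hrsub : ball (0 : ℂ) r ⊆ ball 0 R := ball_subset_ball hrR.le
  have hcpt := isCompact_closedBall (0 : ℂ) r
  obtain ⟨M, hM⟩ := hcpt.exists_bound_of_continuousOn (hq.mono hsub)
  obtain ⟨W, hW⟩ := hcpt.exists_bound_of_continuousOn (hu.continuousOn.mono hsub)
  have hunif := Metric.tendstoUniformlyOn_iff.1 (hqs _ hsub hcpt)
  set K : ℝ := |M| + 1
  have hlim : Tendsto (fun η : ℝ => gronwallBound 0 K (η * W) 1) (𝓝[>] 0) (𝓝 0) := by
    have hc : Continuous fun η : ℝ => gronwallBound 0 K (η * W) 1 :=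
      (gronwallBound_continuous_ε 0 K 1).comp (continuous_id.mul continuous_const)
    have h := hc.tendsto 0
    rw [zero_mul, gronwallBound_ε0_δ0] at h
    exact h.mono_left nhdsWithin_le_nhds
  rw [Metric.tendstoUniformlyOn_iff]
  intro ε hε
  obtain ⟨η, hηε, hη0, hη1⟩ :=
    ((hlim.eventually (gt_mem_nhds hε)).and (Ioo_mem_nhdsGT (zero_lt_one' ℝ))).exists
  filter_upwards [hunif η hη0] with i hi z hz
  have hdiff {y : ℂ} (hy : y ∈ ball (0 : ℂ) R) :
      deriv (us i - u) y = deriv (us i) y - deriv u y :=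
    deriv_sub ((hus i).differentiableAt (isOpen_ball.mem_nhds hy))
      (hu.differentiableAt (isOpen_ball.mem_nhds hy))
  have hdiff2 {y : ℂ} (hy : y ∈ ball (0 : ℂ) R) :
      deriv (deriv (us i - u)) y = deriv (deriv (us i)) y - deriv (deriv u) y := by
    have hev : deriv (us i - u) =ᶠ[𝓝 y] deriv (us i) - deriv u :=
      eventually_of_mem (isOpen_ball.mem_nhds hy) fun x hx => hdiff hx
    rw [hev.deriv_eq]
    exact deriv_sub (((hus i).deriv isOpen_ball).differentiableAt (isOpen_ball.mem_nhds hy))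
      ((hu.deriv isOpen_ball).differentiableAt (isOpen_ball.mem_nhds hy))
  have hclose {y : ℂ} (hy : y ∈ ball (0 : ℂ) r) : ‖q y - qs i y‖ < η := by
    simpa only [dist_eq_norm] using hi y (ball_subset_closedBall hy)
  have hbound := norm_le_gronwallBound_of_norm_deriv_deriv_add_mul_le (d := us i - u)
    (q := qs i) (K := K) (ε := η * W) (hrR.le.trans hR)
    (le_add_of_nonneg_left (abs_nonneg M)) (((hus i).sub hu).mono hrsub) ?_ ?_ (hCr hz)
  · have hinit : deriv (us i - u) 0 = 0 := by
      rw [hdiff (mem_ball_self (pos_of_mem_ball (hCR hz))), h0', sub_self]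
    have hinit0 : (us i - u) 0 = 0 := by rw [Pi.sub_apply, h0, sub_self]
    rw [hinit, hinit0, Prod.mk_zero_zero, norm_zero] at hbound
    rw [dist_comm, dist_eq_norm]
    exact hbound.trans_lt hηε
  · intro y hy
    calc ‖qs i y‖ = ‖q y - (q y - qs i y)‖ := by rw [sub_sub_cancel]
      _ ≤ ‖q y‖ + ‖q y - qs i y‖ := norm_sub_le _ _
      _ ≤ |M| + 1 := add_le_add ((hM y (ball_subset_closedBall hy)).trans (le_abs_self M))
          ((hclose hy).le.trans hη1.le)
  · intro y hy
    have hres : deriv (deriv (us i - u)) y + qs i y * (us i - u) y = (q y - qs i y) * u y := by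
      rw [hdiff2 (hrsub hy), Pi.sub_apply]
      linear_combination hodes i y (hrsub hy) - hode y (hrsub hy)
    rw [hres, norm_mul]
    exact mul_le_mul (hclose hy).le (hW y (ball_subset_closedBall hy)) (norm_nonneg _) hη0.le

/-- **Locally uniform convergence of solutions of Hill's equation with truncated
potentials.**  Let `D` be the open unit disk, `ρ` holomorphic on `D`, and let `wₙ`
be the (unique) holomorphic solution of Hill's equation on `D` whose potential is a
quarter of the Taylor polynomial of `ρ` at `0` of order `n`, with fixed initial data
`wₙ 0 = w₀`, `wₙ' 0 = w₀'`.  Then `wₙ` converges locally uniformly on `D` to the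
solution `w` of `w'' + (ρ/4)·w = 0` with the same initial data. -/
theorem hill_truncated_locally_uniform_convergence
    (ρ : ℂ → ℂ) (hρ : DifferentiableOn ℂ ρ (Metric.ball (0 : ℂ) 1))
    (w₀ w₀' : ℂ) (w : ℂ → ℂ) (wseq : ℕ → ℂ → ℂ)
    (hw : DifferentiableOn ℂ w (Metric.ball (0 : ℂ) 1))
    (hwode : ∀ z ∈ Metric.ball (0 : ℂ) 1, deriv (deriv w) z + ρ z / 4 * w z = 0)
    (hw0 : w 0 = w₀) (hw0' : deriv w 0 = w₀')
    (hwn : ∀ n, DifferentiableOn ℂ (wseq n) (Metric.ball (0 : ℂ) 1))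
    (hwnode : ∀ n, ∀ z ∈ Metric.ball (0 : ℂ) 1,
      deriv (deriv (wseq n)) z
        + (∑ k ∈ Finset.range (n + 1),
            iteratedDeriv k ρ 0 / (Nat.factorial k) * z ^ k) / 4 * wseq n z = 0)
    (hwn0 : ∀ n, wseq n 0 = w₀) (hwn0' : ∀ n, deriv (wseq n) 0 = w₀') :
    TendstoLocallyUniformlyOn wseq w Filter.atTop (Metric.ball (0 : ℂ) 1) := by
  have htaylor := hρ.tendstoLocallyUniformlyOn_taylor
  simp only [sub_zero] at htaylor
  have hquarter : UniformContinuous fun x : ℂ => x / 4 := uniformContinuous_div_const' 4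
  refine tendstoLocallyUniformlyOn_of_deriv_deriv_add_mul_eq_zero le_rfl
    (hρ.continuousOn.div_const 4) (hquarter.comp_tendstoLocallyUniformlyOn htaylor) hw hwode hwn
    hwnode (fun n => ?_) (fun n => ?_)
  · rw [hwn0, hw0]
  · rw [hwn0', hw0']
end

section
/- For holomorphic functions f with nonvanishing derivative define recursively s₂(f) = f‴/f′ − (3/2)(f″/f′)² and s_{ℓ+1}(f) = (s_ℓ(f))′ − ℓ·s_ℓ(f)·(f″/f′) for ℓ ≥ 2. Let a, b, c, d ∈ ℂ with ad − bc = 1, let m(z) = (az + b)/(cz + d), let U ⊆ ℂ be an open set with cz + d ≠ 0 for all z ∈ U, and let f be holomorphic with nonvanishing derivative on an open set containing m(U). Then for every ℓ ≥ 2 and every z ∈ U one has s_ℓ(f ∘ m)(z) = s_ℓ(f)(m(z)) · (m′(z))^ℓ; that is, the higher order Schwarzian operators s_ℓ transform as differentials of degree ℓ under Möbius coordinate changes. -/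
/-- The classical Schwarzian derivative `S(f) = f‴/f′ − (3/2)(f″/f′)²`. -/
noncomputable def schwarzian (f : ℂ → ℂ) (z : ℂ) : ℂ :=
  iteratedDeriv 3 f z / deriv f z - (3 / 2) * (iteratedDeriv 2 f z / deriv f z) ^ 2

/-- Higher order Schwarzian derivatives: `higherSchwarzian f k` is `s_{k+2}(f)`,
defined recursively by `s₂(f) = S(f)` and
`s_{ℓ+1}(f) = (s_ℓ(f))′ − ℓ·s_ℓ(f)·(f″/f′)`. -/
noncomputable def higherSchwarzian (f : ℂ → ℂ) : ℕ → ℂ → ℂ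
  | 0 => schwarzian f
  | (k + 1) => fun z =>
      deriv (higherSchwarzian f k) z
        - ((k : ℂ) + 2) * higherSchwarzian f k z * (iteratedDeriv 2 f z / deriv f z)

theorem iteratedDeriv_two_eq_deriv_deriv (f : ℂ → ℂ) :
    iteratedDeriv 2 f = deriv (deriv f) := by
  rw [iteratedDeriv_succ, iteratedDeriv_one]

theorem iteratedDeriv_three_eq_deriv_deriv_deriv (f : ℂ → ℂ) :
    iteratedDeriv 3 f = deriv (deriv (deriv f)) := by
  rw [iteratedDeriv_succ, iteratedDeriv_two_eq_deriv_deriv]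

theorem differentiableOn_higherSchwarzian {f : ℂ → ℂ} {W : Set ℂ} (hW : IsOpen W)
    (hf : DifferentiableOn ℂ f W) (hf' : ∀ w ∈ W, deriv f w ≠ 0) (k : ℕ) :
    DifferentiableOn ℂ (higherSchwarzian f k) W := by
  have h1 := hf.deriv hW
  have h2 := h1.deriv hW
  have h3 := h2.deriv hW
  induction k with
  | zero =>
    change DifferentiableOn ℂ (fun z => iteratedDeriv 3 f z / deriv f z
      - (3 / 2) * (iteratedDeriv 2 f z / deriv f z) ^ 2) W
    rw [iteratedDeriv_two_eq_deriv_deriv, iteratedDeriv_three_eq_deriv_deriv_deriv]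
    exact (h3.fun_div h1 hf').fun_sub (((h2.fun_div h1 hf').fun_pow 2).const_mul _)
  | succ k ih =>
    change DifferentiableOn ℂ (fun z => deriv (higherSchwarzian f k) z
      - ((k : ℂ) + 2) * higherSchwarzian f k z * (iteratedDeriv 2 f z / deriv f z)) W
    rw [iteratedDeriv_two_eq_deriv_deriv]
    exact (ih.deriv hW).fun_sub ((ih.const_mul _).fun_mul (h2.fun_div h1 hf'))

theorem hasDerivAt_moebius {a b c d : ℂ} (h : a * d - b * c = 1) {m : ℂ → ℂ}
    (hm : ∀ z, m z = (a * z + b) / (c * z + d)) {z : ℂ} (hz : c * z + d ≠ 0) :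
    HasDerivAt m ((c * z + d)⁻¹ ^ 2) z := by
  have h1 : HasDerivAt (fun z => a * z + b) a z := by
    simpa using ((hasDerivAt_id z).const_mul a).add_const b
  have h2 : HasDerivAt (fun z => c * z + d) c z := by
    simpa using ((hasDerivAt_id z).const_mul c).add_const d
  rw [funext hm]
  refine (h1.fun_div h2 hz).congr_deriv ?_
  rw [inv_pow, div_eq_iff (pow_ne_zero 2 hz), inv_mul_cancel₀ (pow_ne_zero 2 hz)]
  linear_combination h

theorem hasDerivAt_comp_moebius_mul_inv_pow {a b c d : ℂ} (h : a * d - b * c = 1) {m : ℂ → ℂ}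
    (hm : ∀ z, m z = (a * z + b) / (c * z + d)) {z : ℂ} (hz : c * z + d ≠ 0)
    {g : ℂ → ℂ} (hg : DifferentiableAt ℂ g (m z)) (n : ℕ) :
    HasDerivAt (fun z => g (m z) * (c * z + d)⁻¹ ^ n)
      (deriv g (m z) * (c * z + d)⁻¹ ^ (n + 2)
        - n * c * g (m z) * (c * z + d)⁻¹ ^ (n + 1)) z := by
  have h2 : HasDerivAt (fun z => c * z + d) c z := by
    simpa using ((hasDerivAt_id z).const_mul c).add_const d
  have h3 := (hg.hasDerivAt.comp z (hasDerivAt_moebius h hm hz)).fun_mul ((h2.fun_inv hz).fun_pow n)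
  refine h3.congr_deriv ?_
  rcases n with _ | n
  · simp
  · simp only [Function.comp_apply, Nat.add_sub_cancel, div_eq_mul_inv, ← inv_pow]
    ring

/-- **Möbius equivariance of the higher order Schwarzian operators.**
Let `m(z) = (az+b)/(cz+d)` with `ad − bc = 1`, let `U` be open with `cz + d ≠ 0` on
`U`, and let `f` be holomorphic with nonvanishing derivative on an open set `W`
containing `m(U)`.  Then for every `ℓ ≥ 2` (here `ℓ = k + 2`) and every `z ∈ U`,
`s_ℓ(f ∘ m)(z) = s_ℓ(f)(m z) · (m′ z)^ℓ`, i.e. the `s_ℓ` transform as differentials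
of degree `ℓ` under Möbius coordinate changes. -/
theorem higherSchwarzian_moebius_covariance
    (a b c d : ℂ) (h : a * d - b * c = 1)
    (U W : Set ℂ) (hU : IsOpen U) (hW : IsOpen W)
    (hcd : ∀ z ∈ U, c * z + d ≠ 0)
    (m : ℂ → ℂ) (hm : ∀ z, m z = (a * z + b) / (c * z + d))
    (f : ℂ → ℂ) (hf : DifferentiableOn ℂ f W) (hf' : ∀ w ∈ W, deriv f w ≠ 0)
    (hmU : Set.MapsTo m U W) :
    ∀ k : ℕ, ∀ z ∈ U,
      higherSchwarzian (f ∘ m) k z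
        = higherSchwarzian f k (m z) * (deriv m z) ^ (k + 2) := by
  have hg {g : ℂ → ℂ} (hg : DifferentiableOn ℂ g W) (n : ℕ) {z : ℂ} (hz : z ∈ U) :=
    hasDerivAt_comp_moebius_mul_inv_pow h hm (hcd z hz)
      (hg.differentiableAt (hW.mem_nhds (hmU hz))) n
  have h1 := hf.deriv hW
  have h2 := h1.deriv hW
  have hm' : ∀ z ∈ U, deriv m z = (c * z + d)⁻¹ ^ 2 := fun z hz =>
    (hasDerivAt_moebius h hm (hcd z hz)).deriv
  have e1 : Set.EqOn (deriv (f ∘ m)) (fun z => deriv f (m z) * (c * z + d)⁻¹ ^ 2) U := by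
    intro z hz
    have := (hg hf 0 hz).deriv
    simpa [Function.comp_def] using this
  have e2 : Set.EqOn (deriv (deriv (f ∘ m))) (fun z =>
      deriv (deriv f) (m z) * (c * z + d)⁻¹ ^ 4
        - 2 * c * (deriv f (m z) * (c * z + d)⁻¹ ^ 3)) U := by
    intro z hz
    rw [e1.deriv hU hz, (hg h1 2 hz).deriv]
    push_cast
    ring
  have e3 : Set.EqOn (deriv (deriv (deriv (f ∘ m)))) (fun z =>
      deriv (deriv (deriv f)) (m z) * (c * z + d)⁻¹ ^ 6
        - 6 * c * (deriv (deriv f) (m z) * (c * z + d)⁻¹ ^ 5)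
        + 6 * c ^ 2 * (deriv f (m z) * (c * z + d)⁻¹ ^ 4)) U := by
    intro z hz
    rw [e2.deriv hU hz, ((hg h2 4 hz).fun_sub ((hg h1 3 hz).const_mul (2 * c))).deriv]
    push_cast
    ring
  intro k
  induction k with
  | zero =>
    intro z hz
    have hz' := hcd z hz
    have hfz := hf' _ (hmU hz)
    simp only [higherSchwarzian, schwarzian, iteratedDeriv_two_eq_deriv_deriv,
      iteratedDeriv_three_eq_deriv_deriv_deriv, zero_add]
    rw [e3 hz, e2 hz, e1 hz, hm' z hz]
    field_simp
    ring
  | succ k ih =>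
    intro z hz
    have hz' := hcd z hz
    have hfz := hf' _ (hmU hz)
    have e : Set.EqOn (higherSchwarzian (f ∘ m) k)
        (fun z => higherSchwarzian f k (m z) * (c * z + d)⁻¹ ^ (2 * (k + 2))) U := by
      intro z hz
      rw [ih z hz, hm' z hz, ← pow_mul]
    have hquot : deriv (deriv (f ∘ m)) z / deriv (f ∘ m) z =
        deriv (deriv f) (m z) / deriv f (m z) * (c * z + d)⁻¹ ^ 2 - 2 * c * (c * z + d)⁻¹ := by
      rw [e2 hz, e1 hz]
      field_simp
    simp only [higherSchwarzian, iteratedDeriv_two_eq_deriv_deriv]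
    rw [hquot, e.deriv hU hz, e hz, hm' z hz,
      (hg (differentiableOn_higherSchwarzian hW hf hf' k) _ hz).deriv]
    push_cast
    ring
end

section
/- Let n ≥ 1 be an integer, a ∈ ℂ \ {0}, b ∈ ℂ, and let h be holomorphic on a disk around 0. Define G(z) = 1 + a z^{n+1} + b z^{n+2} + z^{n+3} h(z), q = −G′/G, γ = q′/(2q), p₂ = S(G) + γ²/2 − γ′ and recursively p_{ℓ+1} = p_ℓ′ − ℓ·γ·p_ℓ for ℓ ≥ 2 (defined on a sufficiently small punctured disk around 0). Then for every ℓ ≥ 2 the function z^ℓ · p_ℓ(z) extends holomorphically across 0, and its value at 0 equals (−1/2)^{ℓ+1} · (ℓ−1)! · n · (n+2)^{ℓ−2} · (3n+4). In particular each p_ℓ has a pole of order exactly ℓ at 0 with residue (−1/2)^{ℓ+1}(ℓ−1)!·(n+2)^{ℓ−2}·(3n²+4n). -/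
/-- The entropy coefficients: `entropy G γ k` is `p_{k+2}`, with
`p₂ = S(G) + γ²/2 − γ′` and `p_{ℓ+1} = p_ℓ′ − ℓ·γ·p_ℓ`. -/
noncomputable def entropy (G γ : ℂ → ℂ) : ℕ → ℂ → ℂ
  | 0 => fun z => schwarzian G z + (γ z) ^ 2 / 2 - deriv γ z
  | (k + 1) => fun z =>
      deriv (entropy G γ k) z - ((k : ℂ) + 2) * γ z * entropy G γ k z

/-- The derivative of a function with a pole of order at most `l` at `0`. -/
lemma hasDerivAt_of_pow_mul_eq {f g : ℂ → ℂ} {U : Set ℂ} (hU : IsOpen U) (l : ℕ)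
    (hg : DifferentiableOn ℂ g U) (hfg : ∀ z ∈ U, z ≠ 0 → z ^ l * f z = g z)
    {z : ℂ} (hz : z ∈ U) (hz0 : z ≠ 0) :
    HasDerivAt f ((z * deriv g z - l * g z) / z ^ (l + 1)) z := by
  have hev : f =ᶠ[nhds z] fun w => g w / w ^ l := by
    filter_upwards [hU.mem_nhds hz, isOpen_ne.mem_nhds hz0] with w hw hw0
    rw [← hfg w hw hw0]
    field_simp
  have hd := ((hg.differentiableAt (hU.mem_nhds hz)).hasDerivAt.div (hasDerivAt_pow l z)
    (pow_ne_zero l hz0)).congr_of_eventuallyEq hev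
  refine hd.congr_deriv ?_
  cases l with
  | zero => simp; field_simp
  | succ m =>
    simp only [Nat.add_sub_cancel]
    field_simp
    ring

/-- In terms of `T = f″/f′`, the Schwarzian derivative is `T′ − T²/2`. -/
lemma schwarzian_eq_deriv_sub {f : ℂ → ℂ} {z : ℂ} (h1 : DifferentiableAt ℂ (deriv f) z)
    (h2 : DifferentiableAt ℂ (deriv (deriv f)) z) (h0 : deriv f z ≠ 0) :
    schwarzian f z = deriv (fun w => deriv (deriv f) w / deriv f w) z
      - (deriv (deriv f) z / deriv f z) ^ 2 / 2 := by
  have hd := (h2.hasDerivAt.div h1.hasDerivAt h0).deriv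
  change deriv (fun w => deriv (deriv f) w / deriv f w) z = _ at hd
  have e2 : iteratedDeriv 2 f = deriv (deriv f) := by simp [iteratedDeriv_succ]
  have e3 : iteratedDeriv 3 f = deriv (deriv (deriv f)) := by simp [iteratedDeriv_succ]
  rw [hd, schwarzian, e2, e3]
  field_simp
  ring

/-- The recursion `p_{ℓ+1} = p_ℓ′ − ℓγp_ℓ` propagates poles of order `ℓ` when `γ` has a simple
pole, multiplying the residue by `−ℓ(1 + res γ)`. -/
lemma entropy_pole_of_simple_pole {G γ c g₀ : ℂ → ℂ} {U : Set ℂ} (hU : IsOpen U)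
    (hc : DifferentiableOn ℂ c U) (hγ : ∀ z ∈ U, z ≠ 0 → z * γ z = c z)
    (hg₀ : DifferentiableOn ℂ g₀ U)
    (hp : ∀ z ∈ U, z ≠ 0 → z ^ 2 * entropy G γ 0 z = g₀ z) (k : ℕ) :
    ∃ g : ℂ → ℂ, DifferentiableOn ℂ g U ∧
      (∀ z ∈ U, z ≠ 0 → z ^ (k + 2) * entropy G γ k z = g z) ∧
      g 0 = (-1) ^ k * (Nat.factorial (k + 1) : ℂ) * (1 + c 0) ^ k * g₀ 0 := by
  induction k with
  | zero => exact ⟨g₀, hg₀, hp, by simp⟩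
  | succ k ih =>
    obtain ⟨g, hg, hgp, hg0⟩ := ih
    refine ⟨fun z => z * deriv g z - ((k : ℂ) + 2) * g z - ((k : ℂ) + 2) * c z * g z, ?_, ?_, ?_⟩
    · have := hg.deriv hU
      fun_prop
    · intro z hz hz0
      have hd := (hasDerivAt_of_pow_mul_eq hU (k + 2) hg hgp hz hz0).deriv
      simp only [entropy]
      rw [hd, ← hγ z hz hz0, ← hgp z hz hz0]
      push_cast
      field_simp
      ring
    · simp only [hg0, Nat.factorial_succ (k + 1)]
      push_cast
      ring

/-- If `G′` vanishes to order `n` at `0` and `γ` is the connection coefficient of `−G′/G`, then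
`γ` has at most a simple pole, with residue `n/2`, and `p₂` at most a double pole, with residue
`−n(3n+4)/8`. -/
lemma exists_extension_connection_and_entropy_zero {G q γ u : ℂ → ℂ} {U : Set ℂ} {n : ℕ}
    (hU : IsOpen U) (hu : DifferentiableOn ℂ u U) (hu0 : ∀ z ∈ U, u z ≠ 0)
    (hG : DifferentiableOn ℂ G U) (hG0 : ∀ z ∈ U, G z ≠ 0)
    (hGu : ∀ z ∈ U, deriv G z = z ^ n * u z)
    (hq : ∀ z, q z = -(deriv G z) / G z) (hγ : ∀ z, γ z = deriv q z / (2 * q z)) :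
    ∃ c g : ℂ → ℂ, DifferentiableOn ℂ c U ∧ (∀ z ∈ U, z ≠ 0 → z * γ z = c z) ∧
      c 0 = n / 2 ∧ DifferentiableOn ℂ g U ∧
      (∀ z ∈ U, z ≠ 0 → z ^ 2 * entropy G γ 0 z = g z) ∧
      g 0 = -(n * (3 * n + 4)) / 8 := by
  have hu' := hu.deriv hU
  have hG' := hG.deriv hU
  have hG'' := hG'.deriv hU
  have hG'0 : ∀ z ∈ U, z ≠ 0 → deriv G z ≠ 0 := fun z hz hz0 => by
    rw [hGu z hz]
    exact mul_ne_zero (pow_ne_zero n hz0) (hu0 z hz)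
  let t : ℂ → ℂ := fun z => n + z * (deriv u z / u z)
  let c : ℂ → ℂ := fun z => (t z - z * (deriv G z / G z)) / 2
  have ht : DifferentiableOn ℂ t U := by
    have := hu'.div hu hu0
    exact (differentiableOn_const _).add (differentiableOn_id.mul this)
  have hc : DifferentiableOn ℂ c U := by
    have := hG'.div hG hG0
    exact (ht.sub (differentiableOn_id.mul this)).div_const 2
  have hT : ∀ z ∈ U, z ≠ 0 → z ^ 1 * (deriv (deriv G) z / deriv G z) = t z := by
    intro z hz hz0
    have hev : deriv G =ᶠ[nhds z] fun w => w ^ n * u w := by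
      filter_upwards [hU.mem_nhds hz] with w hw using hGu w hw
    have hd := (((hasDerivAt_pow n z).mul
      (hu.differentiableAt (hU.mem_nhds hz)).hasDerivAt).congr_of_eventuallyEq hev).deriv
    have := hu0 z hz
    rw [hd, hGu z hz]
    simp only [t]
    cases n with
    | zero => simp
    | succ m =>
      simp only [Nat.add_sub_cancel]
      field_simp
      ring
  have hγc : ∀ z ∈ U, z ≠ 0 → z ^ 1 * γ z = c z := by
    intro z hz hz0
    have h1 := (hG'.differentiableAt (hU.mem_nhds hz)).hasDerivAt
    have h2 := (hG.differentiableAt (hU.mem_nhds hz)).hasDerivAt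
    have hd := (h1.neg.div h2 (hG0 z hz)).deriv
    have hqe : q = -deriv G / G := funext hq
    have n1 := hG0 z hz
    have n2 := hG'0 z hz hz0
    rw [hγ, hqe, hd]
    simp only [c, ← hT z hz hz0, Pi.div_apply, Pi.neg_apply]
    field_simp
    ring
  refine ⟨c, fun z => (z * deriv t z - t z) - t z ^ 2 / 2 + c z ^ 2 / 2 - (z * deriv c z - c z),
    hc, fun z hz hz0 => by rw [← hγc z hz hz0, pow_one], by simp [c, t], ?_, ?_, ?_⟩
  · have := ht.deriv hU
    have := hc.deriv hU
    fun_prop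
  · intro z hz hz0
    have hS := schwarzian_eq_deriv_sub (hG'.differentiableAt (hU.mem_nhds hz))
      (hG''.differentiableAt (hU.mem_nhds hz)) (hG'0 z hz hz0)
    have hdT := (hasDerivAt_of_pow_mul_eq hU 1 ht hT hz hz0).deriv
    have hdγ := (hasDerivAt_of_pow_mul_eq hU 1 hc hγc hz hz0).deriv
    simp only [entropy]
    rw [hS, hdT, hdγ, ← hT z hz hz0, ← hγc z hz hz0]
    field_simp
    ring
  · simp [c, t]
    ring

/-- **Pole structure and residues of all entropy coefficients at an umbilic point.**
With `G(z) = 1 + a z^{n+1} + b z^{n+2} + z^{n+3} h(z)` (`n ≥ 1`, `a ≠ 0`,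
`h` holomorphic near `0`), `q = −G′/G`, `γ = q′/(2q)` and `p_ℓ` the entropy
coefficients (`p_ℓ = entropy G γ (ℓ−2)`), there is `r > 0` such that for every
`ℓ = k + 2 ≥ 2` the function `z^ℓ · p_ℓ(z)` extends holomorphically across `0` with
value `(−1/2)^{ℓ+1}·(ℓ−1)!·n·(n+2)^{ℓ−2}·(3n+4)` at `0`; i.e. `p_ℓ` has a pole of
order exactly `ℓ` at `0` with residue `(−1/2)^{ℓ+1}(ℓ−1)!(n+2)^{ℓ−2}(3n²+4n)`. -/
theorem entropy_poles_and_residues_at_umbilic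
    (n : ℕ) (hn : 1 ≤ n) (a b : ℂ) (ha : a ≠ 0)
    (R : ℝ) (hR : 0 < R) (h G q γ : ℂ → ℂ)
    (hh : DifferentiableOn ℂ h (Metric.ball (0 : ℂ) R))
    (hG : ∀ z, G z = 1 + a * z ^ (n + 1) + b * z ^ (n + 2) + z ^ (n + 3) * h z)
    (hq : ∀ z, q z = -(deriv G z) / G z)
    (hγ : ∀ z, γ z = deriv q z / (2 * q z)) :
    ∃ r : ℝ, 0 < r ∧ r ≤ R ∧
      ∀ k : ℕ, ∃ g : ℂ → ℂ, DifferentiableOn ℂ g (Metric.ball (0 : ℂ) r) ∧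
        (∀ z ∈ Metric.ball (0 : ℂ) r, z ≠ 0 →
          z ^ (k + 2) * entropy G γ k z = g z) ∧
        g 0 = (-(1 : ℂ) / 2) ^ (k + 3) * (Nat.factorial (k + 1) : ℂ) * (n : ℂ)
                * ((n : ℂ) + 2) ^ k * (3 * (n : ℂ) + 4) := by
  have hB : IsOpen (Metric.ball (0 : ℂ) R) := Metric.isOpen_ball
  have h0B : (0 : ℂ) ∈ Metric.ball (0 : ℂ) R := Metric.mem_ball_self hR
  have hh' := hh.deriv hB
  have hGe : G = fun z => 1 + a * z ^ (n + 1) + b * z ^ (n + 2) + z ^ (n + 3) * h z := funext hG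
  have hGd : DifferentiableOn ℂ G (Metric.ball (0 : ℂ) R) := by
    rw [hGe]
    fun_prop
  let u : ℂ → ℂ := fun z => (n + 1) * a + (n + 2) * b * z + (n + 3) * z ^ 2 * h z
    + z ^ 3 * deriv h z
  have hu : DifferentiableOn ℂ u (Metric.ball (0 : ℂ) R) := by
    simp only [u]
    fun_prop
  have hGu : ∀ z ∈ Metric.ball (0 : ℂ) R, deriv G z = z ^ n * u z := by
    intro z hz
    have hd := ((((hasDerivAt_pow (n + 1) z).const_mul a).const_add 1).add
      ((hasDerivAt_pow (n + 2) z).const_mul b)).add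
      ((hasDerivAt_pow (n + 3) z).mul (hh.differentiableAt (hB.mem_nhds hz)).hasDerivAt)
    rw [hGe]
    refine hd.deriv.trans ?_
    simp only [u, Nat.add_sub_cancel, show n + 2 - 1 = n + 1 by omega,
      show n + 3 - 1 = n + 2 by omega]
    push_cast
    ring
  have hu0 : u 0 ≠ 0 := by
    simpa [u, ha] using Nat.cast_add_one_ne_zero (R := ℂ) n
  have hG0 : G 0 ≠ 0 := by simp [hG]
  have hev : ∀ᶠ z in nhds (0 : ℂ), u z ≠ 0 ∧ G z ≠ 0 ∧ z ∈ Metric.ball (0 : ℂ) R :=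
    ((hu.continuousOn.continuousAt (hB.mem_nhds h0B)).eventually_ne hu0).and
      (((hGd.continuousOn.continuousAt (hB.mem_nhds h0B)).eventually_ne hG0).and
        (hB.mem_nhds h0B))
  obtain ⟨ε, hε, hball⟩ := Metric.eventually_nhds_iff_ball.mp hev
  have hsub : Metric.ball (0 : ℂ) (min ε R) ⊆ Metric.ball 0 R :=
    Metric.ball_subset_ball (min_le_right _ _)
  have hsub' : Metric.ball (0 : ℂ) (min ε R) ⊆ Metric.ball 0 ε :=
    Metric.ball_subset_ball (min_le_left _ _)
  refine ⟨min ε R, lt_min hε hR, min_le_right _ _, fun k => ?_⟩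
  obtain ⟨c, g₀, hc, hγc, hc0, hg₀, hp, hg₀0⟩ :=
    exists_extension_connection_and_entropy_zero (n := n) Metric.isOpen_ball (hu.mono hsub)
      (fun z hz => (hball z (hsub' hz)).1) (hGd.mono hsub)
      (fun z hz => (hball z (hsub' hz)).2.1) (fun z hz => hGu z (hsub hz)) hq hγ
  obtain ⟨g, hg, hgp, hg0⟩ := entropy_pole_of_simple_pole Metric.isOpen_ball hc hγc hg₀ hp k
  refine ⟨g, hg, hgp, ?_⟩
  have e : (1 + (n : ℂ) / 2) ^ k = (1 / 2) ^ k * ((n : ℂ) + 2) ^ k := by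
    rw [← mul_pow]
    ring
  have e' : (-(1 : ℂ) / 2) ^ k = (-1) ^ k * (1 / 2) ^ k := by
    rw [← mul_pow]
    ring
  rw [hg0, hc0, hg₀0, e, pow_add, e']
  ring
end

section
/- Let k ≥ 2 be an integer. On ℂ \ {0}, let G(z) = z^k and γ(z) = (k−1)/(2z) (corresponding to the Enneper surface with dihedral symmetry, whose Hopf differential is −k z^{k−1} dz²). Then the entropy coefficients satisfy p₂(z) = −(k−1)(3k+1)/(8z²), p₃(z) = (k−1)(k+1)(3k+1)/(8z³), p₄(z) = −3(k+1)²(k−1)(3k+1)/(16z⁴), and consequently p₄(z) + (12(k+1)²/((k−1)(3k+1)))·p₂(z)² = 0 for all z ≠ 0; hence these surfaces have degree four with coefficient 12(k+1)²/((k−1)(3k+1)). -/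
theorem deriv_const_div_pow (c z : ℂ) (hz : z ≠ 0) (m : ℕ) :
    deriv (fun w => c / w ^ m) z = -(m * c) / z ^ (m + 1) := by
  have h := ((hasDerivAt_zpow (-(m : ℤ)) z (Or.inl hz)).const_mul c).deriv
  have hfun : (fun w : ℂ => c / w ^ m) = fun w => c * w ^ (-(m : ℤ)) := by
    funext w
    rw [zpow_neg, zpow_natCast, div_eq_mul_inv]
  rw [hfun, h, show (-(m : ℤ) - 1) = -((m + 1 : ℕ) : ℤ) by push_cast; ring, zpow_neg,
    zpow_natCast]
  push_cast
  ring

/-- The Schwarzian derivative of `z ^ k` is `(1 - k ^ 2) / (2 * z ^ 2)`. -/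
theorem schwarzian_pow (k : ℕ) (hk : k ≠ 0) (z : ℂ) (hz : z ≠ 0) :
    schwarzian (fun w => w ^ k) z = (1 - (k : ℂ) ^ 2) / (2 * z ^ 2) := by
  have hk' : (k : ℂ) ≠ 0 := Nat.cast_ne_zero.mpr hk
  have h1 : deriv (fun w : ℂ => w ^ k) z = k * (z ^ k / z) := by
    rw [deriv_pow_field, pow_sub₀ z hz (by omega), pow_one, div_eq_mul_inv]
  have h2 : iteratedDeriv 2 (fun w : ℂ => w ^ k) z = k * (k - 1) * (z ^ k / z ^ 2) := by
    rw [iteratedDeriv_eq_iterate, iter_deriv_pow]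
    obtain rfl | h : k = 1 ∨ 2 ≤ k := by omega
    · simp [Finset.prod_range_succ]
    · simp [Finset.prod_range_succ, pow_sub₀ z hz h, div_eq_mul_inv]
  have h3 : iteratedDeriv 3 (fun w : ℂ => w ^ k) z
      = k * (k - 1) * (k - 2) * (z ^ k / z ^ 3) := by
    rw [iteratedDeriv_eq_iterate, iter_deriv_pow]
    obtain rfl | rfl | h : k = 1 ∨ k = 2 ∨ 3 ≤ k := by omega
    · simp [Finset.prod_range_succ]
    · simp [Finset.prod_range_succ]
    · simp [Finset.prod_range_succ, pow_sub₀ z hz h, div_eq_mul_inv]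
  rw [schwarzian, h1, h2, h3]
  have hzk : z ^ k ≠ 0 := pow_ne_zero k hz
  generalize z ^ k = u at hzk
  field_simp
  ring

/-- If `p_{j+2}` equals `c / z ^ m` away from the origin and `γ = a / (2 * z)`, then `p_{j+3}`
is a multiple of `1 / z ^ (m + 1)`. -/
theorem entropy_succ_of_eq_div_pow (G : ℂ → ℂ) (a c : ℂ) (j m : ℕ)
    (h : ∀ z : ℂ, z ≠ 0 → entropy G (fun w => a / (2 * w)) j z = c / z ^ m)
    (z : ℂ) (hz : z ≠ 0) :
    entropy G (fun w => a / (2 * w)) (j + 1) z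
      = -((m + (j + 2) * a / 2) * c) / z ^ (m + 1) := by
  have hev : entropy G (fun w => a / (2 * w)) j =ᶠ[nhds z] fun w => c / w ^ m :=
    (eventually_ne_nhds hz).mono h
  simp only [entropy]
  rw [hev.deriv_eq, deriv_const_div_pow c z hz m, h z hz]
  field_simp
  ring

/-- **Enneper surfaces with higher dihedral symmetry have degree four.**
For `k ≥ 2`, with Gauss map `G(z) = z^k` and connection coefficient
`γ(z) = (k−1)/(2z)` on `ℂ \ {0}`, the entropy coefficients are
`p₂ = −(k−1)(3k+1)/(8z²)`, `p₃ = (k−1)(k+1)(3k+1)/(8z³)`,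
`p₄ = −3(k+1)²(k−1)(3k+1)/(16z⁴)`, and consequently
`p₄ + (12(k+1)²/((k−1)(3k+1)))·p₂² = 0`. -/
theorem enneper_dihedral_degree_four (k : ℕ) (hk : 2 ≤ k) :
    ∀ z : ℂ, z ≠ 0 →
      entropy (fun w => w ^ k) (fun w => ((k : ℂ) - 1) / (2 * w)) 0 z
          = -(((k : ℂ) - 1) * (3 * (k : ℂ) + 1)) / (8 * z ^ 2) ∧
      entropy (fun w => w ^ k) (fun w => ((k : ℂ) - 1) / (2 * w)) 1 z
          = ((k : ℂ) - 1) * ((k : ℂ) + 1) * (3 * (k : ℂ) + 1) / (8 * z ^ 3) ∧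
      entropy (fun w => w ^ k) (fun w => ((k : ℂ) - 1) / (2 * w)) 2 z
          = -(3 * ((k : ℂ) + 1) ^ 2 * ((k : ℂ) - 1) * (3 * (k : ℂ) + 1)) / (16 * z ^ 4) ∧
      entropy (fun w => w ^ k) (fun w => ((k : ℂ) - 1) / (2 * w)) 2 z
          + (12 * ((k : ℂ) + 1) ^ 2 / (((k : ℂ) - 1) * (3 * (k : ℂ) + 1)))
            * (entropy (fun w => w ^ k) (fun w => ((k : ℂ) - 1) / (2 * w)) 0 z) ^ 2
          = 0 := by
  have hp₂ (z : ℂ) (hz : z ≠ 0) :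
      entropy (fun w => w ^ k) (fun w => ((k : ℂ) - 1) / (2 * w)) 0 z
        = -(((k : ℂ) - 1) * (3 * (k : ℂ) + 1)) / 8 / z ^ 2 := by
    have hγ : deriv (fun w : ℂ => ((k : ℂ) - 1) / (2 * w)) z = -(((k : ℂ) - 1) / 2) / z ^ 2 := by
      have h := deriv_const_div_pow (((k : ℂ) - 1) / 2) z hz 1
      simpa [div_div] using h
    simp only [entropy]
    rw [schwarzian_pow k (by omega) z hz, hγ]
    field_simp
    ring
  have hp₃ := entropy_succ_of_eq_div_pow _ _ _ 0 2 hp₂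
  have hp₄ := entropy_succ_of_eq_div_pow _ _ _ 1 3 hp₃
  intro z hz
  have hk₁ : (k : ℂ) - 1 ≠ 0 := sub_ne_zero.mpr (Nat.cast_ne_one.mpr (by omega))
  have hk₂ : 3 * (k : ℂ) + 1 ≠ 0 := by exact_mod_cast (by omega : 3 * k + 1 ≠ 0)
  rw [hp₂ z hz, hp₃ z hz, hp₄ z hz]
  push_cast
  refine ⟨?_, ?_, ?_, ?_⟩ <;> field_simp <;> ring
end

section
/- Let t > 0, let G(z) = (1/t)e^{−z} on ℂ and γ ≡ 1/2 (corresponding to Weierstrass data with Hopf differential 2t e^z dz²). Then the entropy coefficients satisfy p₂ ≡ −3/8, p₃ ≡ 3/8, p₄ ≡ −9/16, and hence p₄ + 4·p₂² = 0; i.e. this family realizes the limit coefficient 4 = lim_{n→∞} 12(n+2)²/(3n²+4n) among degree four surfaces. -/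
theorem iteratedDeriv_const_mul_exp_neg (c : ℂ) (n : ℕ) :
    iteratedDeriv n (fun w : ℂ => c * Complex.exp (-w)) =
      fun w => (-1) ^ n * c * Complex.exp (-w) := by
  induction n with
  | zero => simp
  | succ n ih =>
    rw [iteratedDeriv_succ, ih]
    funext z
    have h := ((hasDerivAt_id z).neg.cexp).const_mul ((-1) ^ n * c)
    refine (h.congr_deriv ?_).deriv
    simp only [Pi.neg_apply, id]
    ring

theorem schwarzian_const_mul_exp_neg {c : ℂ} (hc : c ≠ 0) (z : ℂ) :
    schwarzian (fun w => c * Complex.exp (-w)) z = -(1 / 2) := by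
  have he := Complex.exp_ne_zero (-z)
  rw [schwarzian, ← iteratedDeriv_one]
  simp only [iteratedDeriv_const_mul_exp_neg]
  field_simp
  ring

/-- A constant connection coefficient turns the recursion for a constant entropy coefficient
into multiplication by a scalar. -/
theorem entropy_succ_of_const {G : ℂ → ℂ} {g a : ℂ} {k : ℕ}
    (h : ∀ z, entropy G (fun _ => g) k z = a) (z : ℂ) :
    entropy G (fun _ => g) (k + 1) z = -(((k : ℂ) + 2) * g * a) := by
  simp only [entropy, funext h, deriv_const]
  ring

theorem tendsto_degree_four_coefficient :
    Filter.Tendsto (fun n : ℕ => 12 * ((n : ℝ) + 2) ^ 2 / (3 * (n : ℝ) ^ 2 + 4 * (n : ℝ)))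
      Filter.atTop (nhds 4) := by
  have h0 : Filter.Tendsto (fun n : ℕ => ((n : ℝ))⁻¹) Filter.atTop (nhds 0) :=
    tendsto_inv_atTop_nhds_zero_nat
  have h : Filter.Tendsto
      (fun n : ℕ => 12 * (1 + 2 * (n : ℝ)⁻¹) ^ 2 / (3 + 4 * (n : ℝ)⁻¹))
      Filter.atTop (nhds (12 * (1 + 2 * 0) ^ 2 / (3 + 4 * 0))) :=
    ((((h0.const_mul 2).const_add 1).pow 2).const_mul 12).div
      ((h0.const_mul 4).const_add 3) (by norm_num)
  norm_num at h
  refine h.congr' ?_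
  filter_upwards [Filter.eventually_gt_atTop 0] with n hn
  have hn' : (0 : ℝ) < n := by exact_mod_cast hn
  field_simp

/-- **The limit degree four surfaces.**  For `t > 0`, with Gauss map
`G(z) = (1/t)e^{−z}` and connection coefficient `γ ≡ 1/2` (the Hopf differential is
`2t e^z dz²`), the entropy coefficients are `p₂ ≡ −3/8`, `p₃ ≡ 3/8`, `p₄ ≡ −9/16`,
hence `p₄ + 4·p₂² = 0`; this family realizes the limit coefficient
`4 = lim_{n→∞} 12(n+2)²/(3n²+4n)` among degree four surfaces. -/
theorem limit_degree_four_family (t : ℝ) (ht : 0 < t) :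
    (∀ z : ℂ, entropy (fun w => (1 / (t : ℂ)) * Complex.exp (-w)) (fun _ => 1 / 2) 0 z
        = -(3 / 8)) ∧
    (∀ z : ℂ, entropy (fun w => (1 / (t : ℂ)) * Complex.exp (-w)) (fun _ => 1 / 2) 1 z
        = 3 / 8) ∧
    (∀ z : ℂ, entropy (fun w => (1 / (t : ℂ)) * Complex.exp (-w)) (fun _ => 1 / 2) 2 z
        = -(9 / 16)) ∧
    (∀ z : ℂ,
      entropy (fun w => (1 / (t : ℂ)) * Complex.exp (-w)) (fun _ => 1 / 2) 2 z
        + 4 * (entropy (fun w => (1 / (t : ℂ)) * Complex.exp (-w)) (fun _ => 1 / 2) 0 z) ^ 2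
        = 0) ∧
    Filter.Tendsto (fun n : ℕ => 12 * ((n : ℝ) + 2) ^ 2 / (3 * (n : ℝ) ^ 2 + 4 * (n : ℝ)))
      Filter.atTop (nhds 4) := by
  have hc : (1 / (t : ℂ)) ≠ 0 := one_div_ne_zero (by exact_mod_cast ht.ne')
  have h0 : ∀ z : ℂ,
      entropy (fun w => (1 / (t : ℂ)) * Complex.exp (-w)) (fun _ => 1 / 2) 0 z = -(3 / 8) := by
    intro z
    simp only [entropy, schwarzian_const_mul_exp_neg hc, deriv_const]
    norm_num
  have h1 : ∀ z : ℂ,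
      entropy (fun w => (1 / (t : ℂ)) * Complex.exp (-w)) (fun _ => 1 / 2) 1 z = 3 / 8 := by
    intro z
    rw [entropy_succ_of_const h0]
    norm_num
  have h2 : ∀ z : ℂ,
      entropy (fun w => (1 / (t : ℂ)) * Complex.exp (-w)) (fun _ => 1 / 2) 2 z = -(9 / 16) := by
    intro z
    rw [entropy_succ_of_const h1]
    norm_num
  refine ⟨h0, h1, h2, fun z => ?_, tendsto_degree_four_coefficient⟩
  rw [h2, h0]
  norm_num
end

section
/- On U = {z ∈ ℂ : z⁴ ≠ 1}, let G(z) = z and γ(z) = −2z³/(z⁴ − 1) (corresponding to the singly periodic Scherk surface, whose Hopf differential is −i/(z⁴−1) dz²). Then the entropy coefficients satisfy p₂(z) = −6z²/(z⁴−1)², p₃(z) = 12z(z⁴+1)/(z⁴−1)³, p₄(z) = −12(z⁸+10z⁴+1)/(z⁴−1)⁴, p₅(z) = 576z³(z⁴+1)/(z⁴−1)⁵, and consequently p₅ + 8·p₂·p₃ = 0 on U; hence the Scherk family has degree 5 with coefficient 8 = lim_{n→∞} 24(n+2)²/(n(3n+4)). -/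
/-- Derivative of a quotient by a power of `w⁴ − 1`. -/
theorem hasDerivAt_div_pow_four_sub_one {N : ℂ → ℂ} {N' z : ℂ} (hN : HasDerivAt N N' z)
    (hz : z ^ 4 ≠ 1) (m : ℕ) :
    HasDerivAt (fun w => N w / (w ^ 4 - 1) ^ m)
      ((N' * (z ^ 4 - 1) - 4 * m * z ^ 3 * N z) / (z ^ 4 - 1) ^ (m + 1)) z := by
  have hD : z ^ 4 - 1 ≠ 0 := sub_ne_zero.mpr hz
  have hpow : HasDerivAt (fun w : ℂ => w ^ 4 - 1) (4 * z ^ 3) z := by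
    simpa using (hasDerivAt_pow 4 z).sub_const 1
  refine (hN.fun_div (hpow.fun_pow m) (pow_ne_zero m hD)).congr_deriv ?_
  rcases m with _ | m
  · field_simp
    simp
  · simp only [Nat.add_sub_cancel]
    field_simp
    ring

theorem schwarzian_id (z : ℂ) : schwarzian (fun w => w) z = 0 := by
  have h1 : deriv (fun w : ℂ => w) = fun _ => 1 := by funext w; simp
  simp [schwarzian, iteratedDeriv_succ, iteratedDeriv_zero, h1]

/-- The entropy recursion for the Scherk connection coefficient, on numerators over powers of
`z⁴ − 1`. -/
theorem entropy_succ_of_eq_div {G N N' : ℂ → ℂ} {k m : ℕ}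
    (h : ∀ z : ℂ, z ^ 4 ≠ 1 →
      entropy G (fun w => -2 * w ^ 3 / (w ^ 4 - 1)) k z = N z / (z ^ 4 - 1) ^ m)
    (hN : ∀ z, HasDerivAt N (N' z) z) {z : ℂ} (hz : z ^ 4 ≠ 1) :
    entropy G (fun w => -2 * w ^ 3 / (w ^ 4 - 1)) (k + 1) z
      = (N' z * (z ^ 4 - 1) - (4 * m - 2 * (k + 2)) * z ^ 3 * N z) / (z ^ 4 - 1) ^ (m + 1) := by
  have hD : z ^ 4 - 1 ≠ 0 := sub_ne_zero.mpr hz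
  have hev : entropy G (fun w => -2 * w ^ 3 / (w ^ 4 - 1)) k
      =ᶠ[nhds z] fun w => N w / (w ^ 4 - 1) ^ m := by
    filter_upwards [(continuous_pow 4).continuousAt.eventually_ne hz] with w hw using h w hw
  simp only [entropy]
  rw [hev.deriv_eq, (hasDerivAt_div_pow_four_sub_one (hN z) hz m).deriv, h z hz]
  field_simp
  ring

theorem tendsto_scherk_coefficient :
    Filter.Tendsto
      (fun n : ℕ => 24 * ((n : ℝ) + 2) ^ 2 / ((n : ℝ) * (3 * (n : ℝ) + 4)))
      Filter.atTop (nhds 8) := by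
  have hinv := tendsto_inv_atTop_nhds_zero_nat (𝕜 := ℝ)
  have hlim : Filter.Tendsto
      (fun n : ℕ => 24 * (1 + 2 * (n : ℝ)⁻¹) ^ 2 / (3 + 4 * (n : ℝ)⁻¹))
      Filter.atTop (nhds (24 * (1 + 2 * 0) ^ 2 / (3 + 4 * 0))) :=
    ((((hinv.const_mul 2).const_add 1).pow 2).const_mul 24).div
      ((hinv.const_mul 4).const_add 3) (by norm_num)
  norm_num at hlim
  refine hlim.congr' ?_
  filter_upwards [Filter.eventually_gt_atTop 0] with n hn
  have hn' : (0 : ℝ) < n := by exact_mod_cast hn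
  field_simp

/-- **The Scherk family has degree 5 with coefficient 8.**
On `U = {z : z⁴ ≠ 1}`, with `G(z) = z` and `γ(z) = −2z³/(z⁴−1)` (singly periodic
Scherk surface, Hopf differential `−i/(z⁴−1) dz²`), the entropy coefficients are
`p₂ = −6z²/(z⁴−1)²`, `p₃ = 12z(z⁴+1)/(z⁴−1)³`, `p₄ = −12(z⁸+10z⁴+1)/(z⁴−1)⁴`,
`p₅ = 576z³(z⁴+1)/(z⁴−1)⁵`, and `p₅ + 8·p₂·p₃ = 0`; the coefficient `8` is
`lim_{n→∞} 24(n+2)²/(n(3n+4))`. -/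
theorem scherk_degree_five :
    (∀ z : ℂ, z ^ 4 ≠ 1 →
      entropy (fun w => w) (fun w => -2 * w ^ 3 / (w ^ 4 - 1)) 0 z
          = -6 * z ^ 2 / (z ^ 4 - 1) ^ 2 ∧
      entropy (fun w => w) (fun w => -2 * w ^ 3 / (w ^ 4 - 1)) 1 z
          = 12 * z * (z ^ 4 + 1) / (z ^ 4 - 1) ^ 3 ∧
      entropy (fun w => w) (fun w => -2 * w ^ 3 / (w ^ 4 - 1)) 2 z
          = -12 * (z ^ 8 + 10 * z ^ 4 + 1) / (z ^ 4 - 1) ^ 4 ∧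
      entropy (fun w => w) (fun w => -2 * w ^ 3 / (w ^ 4 - 1)) 3 z
          = 576 * z ^ 3 * (z ^ 4 + 1) / (z ^ 4 - 1) ^ 5 ∧
      entropy (fun w => w) (fun w => -2 * w ^ 3 / (w ^ 4 - 1)) 3 z
          + 8 * entropy (fun w => w) (fun w => -2 * w ^ 3 / (w ^ 4 - 1)) 0 z
              * entropy (fun w => w) (fun w => -2 * w ^ 3 / (w ^ 4 - 1)) 1 z
          = 0) ∧
    Filter.Tendsto
      (fun n : ℕ => 24 * ((n : ℝ) + 2) ^ 2 / ((n : ℝ) * (3 * (n : ℝ) + 4)))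
      Filter.atTop (nhds 8) := by
  refine ⟨?_, tendsto_scherk_coefficient⟩
  have h0 : ∀ z : ℂ, z ^ 4 ≠ 1 →
      entropy (fun w => w) (fun w => -2 * w ^ 3 / (w ^ 4 - 1)) 0 z
        = -6 * z ^ 2 / (z ^ 4 - 1) ^ 2 := by
    intro z hz
    have hD : z ^ 4 - 1 ≠ 0 := sub_ne_zero.mpr hz
    have hd := (hasDerivAt_div_pow_four_sub_one ((hasDerivAt_pow 3 z).const_mul (-2)) hz 1).deriv
    simp only [pow_one] at hd
    simp only [entropy]
    rw [schwarzian_id, hd]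
    push_cast
    field_simp
    ring
  have h1 : ∀ z : ℂ, z ^ 4 ≠ 1 →
      entropy (fun w => w) (fun w => -2 * w ^ 3 / (w ^ 4 - 1)) 1 z
        = 12 * z * (z ^ 4 + 1) / (z ^ 4 - 1) ^ 3 := by
    intro z hz
    rw [entropy_succ_of_eq_div h0 (fun z => (hasDerivAt_pow 2 z).const_mul (-6)) hz]
    push_cast
    ring
  have h2 : ∀ z : ℂ, z ^ 4 ≠ 1 →
      entropy (fun w => w) (fun w => -2 * w ^ 3 / (w ^ 4 - 1)) 2 z
        = -12 * (z ^ 8 + 10 * z ^ 4 + 1) / (z ^ 4 - 1) ^ 4 := by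
    intro z hz
    rw [entropy_succ_of_eq_div h1 (fun z => ((hasDerivAt_id' z).const_mul 12).fun_mul
      ((hasDerivAt_pow 4 z).add_const 1)) hz]
    push_cast
    ring
  have h3 : ∀ z : ℂ, z ^ 4 ≠ 1 →
      entropy (fun w => w) (fun w => -2 * w ^ 3 / (w ^ 4 - 1)) 3 z
        = 576 * z ^ 3 * (z ^ 4 + 1) / (z ^ 4 - 1) ^ 5 := by
    intro z hz
    rw [entropy_succ_of_eq_div h2 (fun z => (((hasDerivAt_pow 8 z).fun_add
      ((hasDerivAt_pow 4 z).const_mul 10)).add_const 1).const_mul (-12)) hz]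
    push_cast
    ring
  intro z hz
  refine ⟨h0 z hz, h1 z hz, h2 z hz, h3 z hz, ?_⟩
  have hD : z ^ 4 - 1 ≠ 0 := sub_ne_zero.mpr hz
  rw [h3 z hz, h0 z hz, h1 z hz]
  field_simp
  ring
end

section
/- Let R(z) = z⁸ − 14z⁴ + 1 and U = {z ∈ ℂ : R(z) ≠ 0}. On U, let G(z) = z and γ(z) = −R′(z)/(4R(z)) = −(2z⁷ − 14z³)/R(z) (corresponding to the Schwarz primitive surface, whose Hopf differential is −(1/w)dz² with w² = R(z)). Then the entropy coefficients satisfy p₂(z) = −42z²(z⁴+1)²/R(z)², p₃(z) = 84z(z¹⁶+34z¹²−34z⁴−1)/R(z)³, p₅(z) = 108864·z³(z²⁴+36z²⁰+69z¹⁶−69z⁸−36z⁴−1)/R(z)⁵, and consequently p₅ + (216/7)·p₂·p₃ = 0 on U; hence the Schwarz family has degree 5 with coefficient 216/7 = 24(n+2)²/(n(3n+4)) for n = 1. -/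
/-- For the connection coefficient `γ = -R' / (4 R)`, the recursion for the entropy coefficients
sends `N / R ^ ℓ` to `(N' R - (3 ℓ / 4) N R') / R ^ (ℓ + 1)`, where `ℓ = k + 2`. -/
theorem entropy_succ_eq_div {G γ R R' N N' : ℂ → ℂ} {k : ℕ}
    (hR : ∀ z, HasDerivAt R (R' z) z) (hN : ∀ z, HasDerivAt N (N' z) z)
    (hγ : ∀ z, R z ≠ 0 → γ z = -R' z / (4 * R z))
    (h : ∀ z, R z ≠ 0 → entropy G γ k z = N z / R z ^ (k + 2)) (z : ℂ) (hz : R z ≠ 0) :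
    entropy G γ (k + 1) z
      = (N' z * R z - 3 * ((k : ℂ) + 2) / 4 * N z * R' z) / R z ^ (k + 1 + 2) := by
  have heq : entropy G γ k =ᶠ[nhds z] fun w => N w / R w ^ (k + 2) :=
    ((hR z).continuousAt.eventually_ne hz).mono h
  have hd := ((hN z).div ((hR z).pow (k + 2)) (pow_ne_zero _ hz)).congr_of_eventuallyEq heq
  simp only [entropy]
  rw [hd.deriv, h z hz, hγ z hz]
  simp only [Pi.pow_apply, show k + 2 - 1 = k + 1 from rfl]
  push_cast
  field_simp
  ring

/-- **The Schwarz family has degree 5 with coefficient 216/7.**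
Let `R(z) = z⁸ − 14z⁴ + 1` and `U = {z : R(z) ≠ 0}`.  With `G(z) = z` and
`γ = −R′/(4R) = −(2z⁷ − 14z³)/R` (Schwarz primitive surface, Hopf differential
`−(1/w)dz²` with `w² = R`), the entropy coefficients satisfy
`p₂ = −42z²(z⁴+1)²/R²`, `p₃ = 84z(z¹⁶+34z¹²−34z⁴−1)/R³`,
`p₅ = 108864z³(z²⁴+36z²⁰+69z¹⁶−69z⁸−36z⁴−1)/R⁵` and `p₅ + (216/7)·p₂·p₃ = 0`;
the coefficient is `216/7 = 24(n+2)²/(n(3n+4))` for `n = 1`. -/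
theorem schwarz_degree_five
    (R γ : ℂ → ℂ) (hR : ∀ z, R z = z ^ 8 - 14 * z ^ 4 + 1)
    (hγ : ∀ z, γ z = -(deriv R z) / (4 * R z)) :
    (∀ z : ℂ, R z ≠ 0 →
      γ z = -(2 * z ^ 7 - 14 * z ^ 3) / R z ∧
      entropy (fun w => w) γ 0 z
          = -42 * z ^ 2 * (z ^ 4 + 1) ^ 2 / (R z) ^ 2 ∧
      entropy (fun w => w) γ 1 z
          = 84 * z * (z ^ 16 + 34 * z ^ 12 - 34 * z ^ 4 - 1) / (R z) ^ 3 ∧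
      entropy (fun w => w) γ 3 z
          = 108864 * z ^ 3
              * (z ^ 24 + 36 * z ^ 20 + 69 * z ^ 16 - 69 * z ^ 8 - 36 * z ^ 4 - 1)
              / (R z) ^ 5 ∧
      entropy (fun w => w) γ 3 z
          + (216 / 7) * entropy (fun w => w) γ 0 z * entropy (fun w => w) γ 1 z
          = 0) ∧
    (216 / 7 : ℝ) = 24 * ((1 : ℝ) + 2) ^ 2 / (1 * (3 * 1 + 4)) := by
  have hd (n : ℕ) (z : ℂ) : HasDerivAt (fun w : ℂ => w ^ n) (n * z ^ (n - 1)) z :=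
    hasDerivAt_pow n z
  have hR' (z : ℂ) : HasDerivAt R (8 * z ^ 7 - 56 * z ^ 3) z := by
    rw [funext hR]
    refine (((hd 8 z).sub ((hd 4 z).const_mul 14)).add_const 1).congr_deriv ?_
    norm_num
    ring
  have hγ' (z : ℂ) (_ : R z ≠ 0) : γ z = -(8 * z ^ 7 - 56 * z ^ 3) / (4 * R z) := by
    rw [hγ, (hR' z).deriv]
  have h2 (z : ℂ) (hz : R z ≠ 0) : entropy (fun w => w) γ 0 z
      = (-42 * z ^ 10 - 84 * z ^ 6 - 42 * z ^ 2) / R z ^ (0 + 2) := by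
    have hnum : HasDerivAt (fun w : ℂ => -(8 * w ^ 7 - 56 * w ^ 3))
        (-(56 * z ^ 6 - 168 * z ^ 2)) z := by
      refine (((hd 7 z).const_mul 8).sub ((hd 3 z).const_mul 56)).neg.congr_deriv ?_
      norm_num
      ring
    have hγd : HasDerivAt γ _ z :=
      (hnum.div ((hR' z).const_mul 4) (mul_ne_zero (by norm_num) hz)).congr_of_eventuallyEq
        (((hR' z).continuousAt.eventually_ne hz).mono hγ')
    simp only [entropy]
    rw [schwarzian_id, hγd.deriv, hγ' z hz]
    field_simp
    rw [hR z]
    ring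
  have h3 (z : ℂ) (hz : R z ≠ 0) : entropy (fun w => w) γ 1 z
      = (84 * z ^ 17 + 2856 * z ^ 13 - 2856 * z ^ 5 - 84 * z ^ 1) / R z ^ (1 + 2) := by
    rw [entropy_succ_eq_div hR' (fun z => (((hd 10 z).const_mul (-42)).sub
      ((hd 6 z).const_mul 84)).sub ((hd 2 z).const_mul 42)) hγ' h2 z hz]
    congr 1
    norm_num [hR z]
    ring
  have h4 (z : ℂ) (hz : R z ≠ 0) : entropy (fun w => w) γ 2 z
      = (-84 * z ^ 24 - 23688 * z ^ 20 - 158508 * z ^ 16 + 74256 * z ^ 12 - 158508 * z ^ 8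
          - 23688 * z ^ 4 - 84) / R z ^ (2 + 2) := by
    rw [entropy_succ_eq_div hR' (fun z => ((((hd 17 z).const_mul 84).add
      ((hd 13 z).const_mul 2856)).sub ((hd 5 z).const_mul 2856)).sub ((hd 1 z).const_mul 84))
      hγ' h3 z hz]
    congr 1
    norm_num [hR z]
    ring
  have h5 (z : ℂ) (hz : R z ≠ 0) : entropy (fun w => w) γ 3 z
      = 108864 * z ^ 3
          * (z ^ 24 + 36 * z ^ 20 + 69 * z ^ 16 - 69 * z ^ 8 - 36 * z ^ 4 - 1) / R z ^ 5 := by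
    rw [entropy_succ_eq_div hR' (fun z => (((((((hd 24 z).const_mul (-84)).sub
      ((hd 20 z).const_mul 23688)).sub ((hd 16 z).const_mul 158508)).add
      ((hd 12 z).const_mul 74256)).sub ((hd 8 z).const_mul 158508)).sub
      ((hd 4 z).const_mul 23688)).sub_const 84) hγ' h4 z hz]
    congr 1
    norm_num [hR z]
    ring
  refine ⟨fun z hz => ⟨?_, ?_, ?_, h5 z hz, ?_⟩, by norm_num⟩
  · rw [hγ' z hz]
    field_simp
    ring
  · rw [h2 z hz]
    ring
  · rw [h3 z hz]
    ring
  · rw [h5 z hz, h2 z hz, h3 z hz]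
    field_simp
    ring
end
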